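/- arXiv:alg-geom/9706011 — 2 statements merged into one kernel-verified Lean document; each statement's English description precedes it below -/
import Mathlib

section
/- Let Γ be a finitely generated group, Γ' ⊆ Γ a finite-index subgroup, N = Γ' ∩ DΓ where DΓ is the derived subgroup, and suppose V = N^{ab} ⊗ Q is finite-dimensional. Then Γ' acts quasiunipotently on V (by conjugation) if and only if every character in Σ¹(Γ') ∩ image(Hom(Γ, C*) → Hom(Γ', C*)) is a torsion character, where Σ¹(Γ') is the set of characters ρ of Γ' with H^1(Γ', C_ρ) ≠ 0. -/
/-- The one-dimensional complex representation attached to a character `ρ`. -/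
noncomputable def charRep {G : Type} [Group G] (ρ : G →* ℂˣ) :
    Representation ℂ G ℂ where
  toFun g := (ρ g : ℂ) • (1 : Module.End ℂ ℂ)
  map_one' := by simp
  map_mul' a b := by
    ext x
    simp [mul_assoc, mul_comm]

/-- `QuotRankLe B C r` says that the abelian quotient `B/C` (where
`[B,B] ≤ C ≤ B`) satisfies `dim_ℚ (ℚ ⊗ B/C) ≤ r`: any `r + 1` elements of `B`
admit a nontrivial `ℤ`-linear relation modulo `C`. -/
def QuotRankLe {G : Type} [Group G] (B C : Subgroup G) (r : ℕ) : Prop :=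
  ∀ f : Fin (r + 1) → G, (∀ j, f j ∈ B) →
    ∃ c : Fin (r + 1) → ℤ, c ≠ 0 ∧ (List.ofFn fun j => f j ^ c j).prod ∈ C

/-- `Γ` is a solvable group of finite rank, of rank at most `r`: it has a
subnormal series with abelian quotients `A_i` such that `ℚ ⊗ A_i` is finite
dimensional and the sum of the dimensions is at most `r`. -/
def SolvableRankLe (Γ : Type) [Group Γ] (r : ℕ) : Prop :=
  ∃ (m : ℕ) (s : ℕ → Subgroup Γ) (d : ℕ → ℕ),
    s 0 = ⊤ ∧ s (m + 1) = ⊥ ∧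
    (∀ i ≤ m, s (i + 1) ≤ s i ∧ ⁅s i, s i⁆ ≤ s (i + 1) ∧
      QuotRankLe (s i) (s (i + 1)) (d i)) ∧
    (Finset.range (m + 1)).sum d ≤ r

/-- `Γ` is a solvable group of finite rank. -/
def SolvableFiniteRank (Γ : Type) [Group Γ] : Prop :=
  ∃ r, SolvableRankLe Γ r

section

open Module
open scoped commutatorElement

/-- A homomorphism into a divisible abelian group extends from any subgroup of an abelian group. -/
theorem AddSubgroup.exists_extension_of_divisible {A D : Type} [AddCommGroup A] [AddCommGroup D]
    [DivisibleBy D ℤ] (S : AddSubgroup A) (f : S →+ D) :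
    ∃ F : A →+ D, ∀ s : S, F s = f s := by
  obtain ⟨F, hF⟩ := (Module.Baer.of_divisible D).extension_property
    (AddSubgroup.toIntSubmodule S).subtype Subtype.val_injective f.toIntLinearMap
  exact ⟨F.toAddMonoidHom, fun s => LinearMap.congr_fun hF s⟩

/-- The multiplicative group of `ℂ` is divisible. -/
noncomputable abbrev additiveUnitsDivisibleBy : DivisibleBy (Additive ℂˣ) ℤ :=
  haveI : RootableBy ℂˣ ℕ := rootableByOfPowLeftSurj _ _ fun {n} hn a => by
    obtain ⟨z, hz⟩ := IsAlgClosed.exists_pow_nat_eq (a : ℂ) (Nat.pos_of_ne_zero hn)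
    have hz0 : z ≠ 0 := by
      rintro rfl
      rw [zero_pow hn] at hz
      exact a.ne_zero hz.symm
    exact ⟨Units.mk0 z hz0, Units.ext (by simpa using hz)⟩
  haveI : RootableBy ℂˣ ℤ := Group.rootableByIntOfRootableByNat _
  { div := fun a n => Additive.ofMul (RootableBy.root a.toMul n)
    div_zero := fun a => congrArg Additive.ofMul (RootableBy.root_zero a.toMul)
    div_cancel := fun a hn => congrArg Additive.ofMul (RootableBy.root_cancel a.toMul hn) }

/-- A complex character of a subgroup `H` that is trivial on the elements of `H` lying in the
derived subgroup extends to the whole group. -/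
theorem exists_character_extension_of_trivial_on_commutator {Γ : Type} [Group Γ] (H : Subgroup Γ)
    (ρ : H →* ℂˣ) (hρ : ∀ x : H, (x : Γ) ∈ commutator Γ → ρ x = 1) :
    ∃ ρ' : Γ →* ℂˣ, ∀ x : H, ρ' x = ρ x := by
  let p : H →* Abelianization Γ := Abelianization.of.comp H.subtype
  have hker : p.rangeRestrict.ker ≤ ρ.ker := by
    intro x hx
    rw [MonoidHom.ker_rangeRestrict] at hx
    refine hρ x ?_
    rw [← Abelianization.ker_of]
    exact hx
  let σ : p.range →* ℂˣ :=
    p.rangeRestrict.liftOfSurjective p.rangeRestrict_surjective ⟨ρ, hker⟩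
  have hσ : ∀ x, σ (p.rangeRestrict x) = ρ x := fun x =>
    MonoidHom.liftOfRightInverse_comp_apply _ _ _ ⟨ρ, hker⟩ x
  let := additiveUnitsDivisibleBy
  obtain ⟨F, hF⟩ := AddSubgroup.exists_extension_of_divisible
    (A := Additive (Abelianization Γ)) (D := Additive ℂˣ) p.range.toAddSubgroup
    (MonoidHom.toAdditive σ)
  refine ⟨(MonoidHom.toAdditive.symm F).comp Abelianization.of, fun x => ?_⟩
  rw [← hσ x]
  exact hF (p.rangeRestrict x)

/-- If every homomorphism `M → ℂ` kills `x`, then `x` is torsion modulo the derived subgroup. -/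
theorem exists_pow_mem_commutator_of_forall_hom {M : Type} [Group M] (x : M)
    (hx : ∀ φ : Additive M →+ ℂ, φ (Additive.ofMul x) = 0) :
    ∃ k : ℕ, 0 < k ∧ x ^ k ∈ commutator M := by
  let y : Additive (Abelianization M) := Additive.ofMul (Abelianization.of x)
  suffices h : IsOfFinAddOrder y by
    obtain ⟨k, hk, hky⟩ := h.exists_nsmul_eq_zero
    refine ⟨k, hk, ?_⟩
    rw [← Abelianization.ker_of, MonoidHom.mem_ker, map_pow]
    exact hky
  by_contra hy
  have hinj : Function.Injective (zmultiplesHom _ y) := by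
    have := injective_zsmul_iff_not_isOfFinAddOrder.2 hy
    exact this
  obtain ⟨F, hF⟩ := (Module.Baer.of_divisible ℂ).extension_property
    (zmultiplesHom _ y).toIntLinearMap hinj (Int.castAddHom ℂ).toIntLinearMap
  have h1 := LinearMap.congr_fun hF 1
  have h2 := hx (F.toAddMonoidHom.comp (MonoidHom.toAdditive Abelianization.of))
  have h3 : F y = 1 := by simpa using h1
  exact one_ne_zero (h3.symm.trans h2)

theorem AddMonoidHom.map_ofMul_eq_zero_of_mem_commutator {M : Type} [Group M]
    (φ : Additive M →+ ℂ) {x : M} (hx : x ∈ commutator M) : φ (Additive.ofMul x) = 0 := by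
  have := Abelianization.commutator_subset_ker (AddMonoidHom.toMultiplicativeRight φ) hx
  exact this

/-- A nonzero invariant subspace of a commuting family of endomorphisms of a finite-dimensional
complex vector space contains a joint eigenvector. -/
theorem Module.End.exists_joint_eigenvector {ι W : Type} [AddCommGroup W] [Module ℂ W]
    [FiniteDimensional ℂ W] (T : ι → End ℂ W) (hT : ∀ i j, Commute (T i) (T j))
    (E : Submodule ℂ W) (hE : E ≠ ⊥) (hinv : ∀ i, ∀ v ∈ E, T i v ∈ E) :
    ∃ v ∈ E, v ≠ 0 ∧ ∃ χ : ι → ℂ, ∀ i, T i v = χ i • v := by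
  obtain ⟨p, ⟨hpE, hp0, hpinv⟩, hmin⟩ := IsArtinian.set_has_minimal
    {p : Submodule ℂ W | p ≤ E ∧ p ≠ ⊥ ∧ ∀ i, ∀ v ∈ p, T i v ∈ p} ⟨E, le_rfl, hE, hinv⟩
  have key : ∀ i, ∃ c : ℂ, ∀ v ∈ p, T i v = c • v := by
    intro i
    have : Nontrivial p := (Submodule.nontrivial_iff_ne_bot).2 hp0
    obtain ⟨c, hc⟩ := Module.End.exists_eigenvalue ((T i).restrict (hpinv i))
    obtain ⟨w, hw⟩ := hc.exists_hasEigenvector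
    have hw1 : T i (w : W) = c • (w : W) := congrArg Subtype.val hw.apply_eq_smul
    refine ⟨c, fun v hv => ?_⟩
    have hnot := hmin (p ⊓ (T i).eigenspace c) ⟨inf_le_left.trans hpE, ?_, ?_⟩
    · have : p ⊓ (T i).eigenspace c = p := by
        by_contra hne
        exact hnot (lt_of_le_of_ne inf_le_left hne)
      rw [← this] at hv
      exact Module.End.mem_eigenspace_iff.1 hv.2
    · rw [Submodule.ne_bot_iff]
      exact ⟨w, ⟨w.2, Module.End.mem_eigenspace_iff.2 hw1⟩, fun h => hw.2 (Subtype.ext h)⟩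
    · rintro j v ⟨hv1, hv2⟩
      refine ⟨hpinv j v hv1, ?_⟩
      rw [SetLike.mem_coe, Module.End.mem_eigenspace_iff] at hv2 ⊢
      rw [← Module.End.mul_apply, (hT i j).eq, Module.End.mul_apply, hv2, map_smul]
  choose χ hχ using key
  obtain ⟨v, hv, hv0⟩ := (Submodule.ne_bot_iff p).1 hp0
  exact ⟨v, hpE hv, hv0, χ, fun i => hχ i v hv⟩

/-- A commuting family of endomorphisms of a finite-dimensional space has finitely many joint
eigencharacters. -/
theorem Module.End.finite_joint_eigenvalues {ι W : Type} [AddCommGroup W] [Module ℂ W]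
    [FiniteDimensional ℂ W] (T : ι → End ℂ W) (hT : ∀ i j, Commute (T i) (T j)) :
    {χ : ι → ℂ | ∃ v : W, v ≠ 0 ∧ ∀ i, T i v = χ i • v}.Finite := by
  have hind := Module.End.independent_iInf_maxGenEigenspace_of_forall_mapsTo T
    fun i j φ => Module.End.mapsTo_maxGenEigenspace_of_comm (hT j i) φ
  refine (WellFoundedGT.finite_ne_bot_of_iSupIndep hind).subset ?_
  rintro χ ⟨v, hv0, hv⟩
  refine (Submodule.ne_bot_iff _).2 ⟨v, ?_, hv0⟩
  rw [Module.End.mem_iInf_maxGenEigenspace_iff]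
  exact fun j => ⟨1, by simp [hv j]⟩

/-- An endomorphism of a finite-dimensional complex space whose only eigenvalue is `1` is
unipotent. -/
theorem Module.End.sub_one_pow_finrank_eq_zero {W : Type} [AddCommGroup W] [Module ℂ W]
    [FiniteDimensional ℂ W] (T : End ℂ W) (hT : ∀ c, T.HasEigenvalue c → c = 1) :
    (T - 1) ^ finrank ℂ W = 0 := by
  have htop : T.maxGenEigenspace 1 = ⊤ := by
    rw [eq_top_iff, ← Module.End.iSup_maxGenEigenspace_eq_top T, iSup_le_iff]
    intro c
    by_cases hc : T.HasEigenvalue c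
    · rw [hT c hc]
    · have : T.maxGenEigenspace c = ⊥ := by
        by_contra hne
        exact hc (Module.End.HasUnifEigenvalue.lt one_pos hne)
      rw [this]
      exact bot_le
  rw [Module.End.maxGenEigenspace_eq_genEigenspace_finrank, Module.End.genEigenspace_nat,
    LinearMap.ker_eq_top, one_smul] at htop
  exact htop

/-- The endomorphism of `Hom(M, ℂ)` given by precomposition with conjugation by `g`. -/
noncomputable def conjDual {G : Type} [Group G] (M : Subgroup G) [M.Normal] (g : G) :
    End ℂ (Additive M →+ ℂ) where
  toFun φ := φ.comp (MonoidHom.toAdditive (MulAut.conjNormal g : MulAut M).toMonoidHom)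
  map_add' _ _ := rfl
  map_smul' _ _ := rfl

theorem conjDual_apply {G : Type} [Group G] (M : Subgroup G) [M.Normal] (g : G)
    (φ : Additive M →+ ℂ) (x : M) :
    conjDual M g φ (Additive.ofMul x) = φ (Additive.ofMul (MulAut.conjNormal g x)) := rfl

theorem conjDual_mul {G : Type} [Group G] (M : Subgroup G) [M.Normal] (g h : G) :
    conjDual M (g * h) = conjDual M h * conjDual M g := by
  refine LinearMap.ext fun φ => AddMonoidHom.ext fun x => ?_
  induction x with
  | ofMul x => simp only [conjDual_apply, Module.End.mul_apply, map_mul, MulAut.mul_apply]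

theorem conjDual_of_mem {G : Type} [Group G] (M : Subgroup G) [M.Normal] {g : G} (hg : g ∈ M) :
    conjDual M g = 1 := by
  refine LinearMap.ext fun φ => AddMonoidHom.ext fun x => ?_
  induction x with
  | ofMul x =>
    have : MulAut.conjNormal g x = (⟨g, hg⟩ : M) * x * (⟨g, hg⟩ : M)⁻¹ := Subtype.ext (by simp)
    rw [conjDual_apply, this]
    simp

theorem conjDual_commute {G : Type} [Group G] (M : Subgroup G) [M.Normal]
    (hM : commutator G ≤ M) (g h : G) : Commute (conjDual M g) (conjDual M h) := by
  have h1 : h * g = ⁅h, g⁆ * (g * h) := by simp [commutatorElement_def, mul_assoc]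
  have h2 : ⁅h, g⁆ ∈ M :=
    hM (Subgroup.commutator_mem_commutator (Subgroup.mem_top h) (Subgroup.mem_top g))
  change conjDual M g * conjDual M h = conjDual M h * conjDual M g
  rw [← conjDual_mul, ← conjDual_mul, h1, conjDual_mul, conjDual_of_mem M h2, mul_one]

theorem map_iterate_commutator {G : Type} [Group G] (M : Subgroup G) [M.Normal] (g : G) (m : ℕ)
    (x : M) : ∃ y : M, (y : G) = (fun y => g * y * g⁻¹ * y⁻¹)^[m] (x : G) ∧
      ∀ φ : Additive M →+ ℂ,
        φ (Additive.ofMul y) = ((conjDual M g - 1) ^ m) φ (Additive.ofMul x) := by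
  induction m with
  | zero => exact ⟨x, rfl, fun φ => rfl⟩
  | succ m ih =>
    obtain ⟨y, hy, hφ⟩ := ih
    refine ⟨MulAut.conjNormal g y * y⁻¹, ?_, fun φ => ?_⟩
    · rw [Function.iterate_succ_apply', ← hy]
      simp
    · rw [pow_succ, Module.End.mul_apply, ← hφ]
      simp [conjDual_apply, sub_eq_add_neg]

theorem finiteDimensional_hom_of_quotRankLe {G : Type} [Group G] (M : Subgroup G) (r : ℕ)
    (hr : QuotRankLe M ⁅M, M⁆ r) : FiniteDimensional ℂ (Additive M →+ ℂ) := by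
  let ev : M → Dual ℂ (Additive M →+ ℂ) := fun x =>
    { toFun := fun φ => φ (Additive.ofMul x)
      map_add' := fun _ _ => rfl
      map_smul' := fun _ _ => rfl }
  obtain ⟨b, hbs, hspan, hb⟩ := exists_linearIndependent ℂ (Set.range ev)
  have hfin : b.Finite := by
    by_contra hinf
    have hinf : b.Infinite := hinf
    have := hinf.to_subtype
    let e : Fin (r + 1) ↪ b := Fin.valEmbedding.trans (Infinite.natEmbedding b)
    choose s hs using fun j => hbs (e j).2
    obtain ⟨c, hc0, hc⟩ := hr (fun j => s j) fun j => (s j).2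
    have hcoe : (List.ofFn fun j => (s j : G) ^ c j).prod
        = ((List.ofFn fun j => s j ^ c j).prod : M) := by
      rw [← M.subtype_apply, map_list_prod, List.map_ofFn]
      rfl
    rw [hcoe, ← M.map_subtype_commutator] at hc
    obtain ⟨z, hz, hze⟩ := hc
    have hz' : (List.ofFn fun j => s j ^ c j).prod ∈ commutator M := by
      rwa [← Subtype.ext hze]
    have hrel : ∑ j, (c j : ℂ) • ((e j : b) : Dual ℂ (Additive M →+ ℂ)) = 0 := by
      ext φ
      have h0 := φ.map_ofMul_eq_zero_of_mem_commutator hz'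
      have h1 : φ (Additive.ofMul (List.ofFn fun j => s j ^ c j).prod)
          = ∑ j, (c j : ℂ) * φ (Additive.ofMul (s j)) := by
        have h2 : ∀ l : List M, φ (Additive.ofMul l.prod)
            = (l.map fun x => φ (Additive.ofMul x)).sum := by
          intro l
          induction l with
          | nil => simp
          | cons a l ih =>
            rw [List.prod_cons, ofMul_mul, map_add, ih, List.map_cons, List.sum_cons]
        rw [h2, List.map_ofFn, List.sum_ofFn]
        simp
      rw [h1] at h0
      simp only [← hs]
      simpa [ev] using h0
    have hli : LinearIndependent ℂ fun j => ((e j : b) : Dual ℂ (Additive M →+ ℂ)) :=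
      hb.comp e e.injective
    have := Fintype.linearIndependent_iff.1 hli _ hrel
    exact hc0 (funext fun j => by simpa using this j)
  have := hfin.to_subtype
  have := Fintype.ofFinite b
  let L : (Additive M →+ ℂ) →ₗ[ℂ] (b → ℂ) := LinearMap.pi fun i => (i : Dual ℂ _)
  refine Module.Finite.of_injective L ?_
  rw [← LinearMap.ker_eq_bot, LinearMap.ker_eq_bot']
  intro φ hφ
  have hle : Submodule.span ℂ b ≤ LinearMap.ker (Dual.eval ℂ (Additive M →+ ℂ) φ) :=
    Submodule.span_le.2 fun i hi => congrFun hφ ⟨i, hi⟩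
  rw [hspan] at hle
  ext x
  exact hle (Submodule.subset_span ⟨Additive.toMul x, rfl⟩)

theorem nontrivial_H1_iff {G : Type} [Group G] (ρ : G →* ℂˣ) :
    Nontrivial (groupCohomology.H1 (Rep.of (charRep ρ))) ↔
      ∃ f : G → ℂ, (∀ g h, f (g * h) = ρ g * f h + f g) ∧ ¬ ∃ c : ℂ, ∀ g, f g = ρ g * c - c := by
  constructor
  · intro h
    obtain ⟨x, hx⟩ := exists_ne (0 : groupCohomology.H1 (Rep.of (charRep ρ)))
    induction x using groupCohomology.H1_induction_on with
    | h x =>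
      rw [Ne, groupCohomology.H1π_eq_zero_iff] at hx
      refine ⟨x.1, fun g h => ?_, ?_⟩
      · exact (groupCohomology.mem_cocycles₁_iff _).1 x.2 g h
      · rintro ⟨c, hc⟩
        exact hx ⟨c, funext fun g => (hc g).symm⟩
  · rintro ⟨f, hf, hnot⟩
    let x : groupCohomology.cocycles₁ (Rep.of (charRep ρ)) :=
      ⟨f, (groupCohomology.mem_cocycles₁_iff (A := Rep.of (charRep ρ)) f).2 hf⟩
    refine ⟨groupCohomology.H1π _ x, 0, fun h => ?_⟩
    rw [groupCohomology.H1π_eq_zero_iff] at h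
    obtain ⟨c, hc⟩ := h
    exact hnot ⟨c, fun g => (congrFun hc g).symm⟩

/-- A non-coboundary cocycle with values in a nontrivial character `ρ` that is trivial on `M`
restricts to a nonzero `ρ`-equivariant homomorphism on `M`. -/
theorem exists_equivariant_hom_of_nontrivial_H1 {G : Type} [Group G] (M : Subgroup G) [M.Normal]
    (hM : commutator G ≤ M) (ρ : G →* ℂˣ) (hρ : ∀ x ∈ M, ρ x = 1) (hne : ρ ≠ 1)
    (hH : Nontrivial (groupCohomology.H1 (Rep.of (charRep ρ)))) :
    ∃ φ : Additive M →+ ℂ, φ ≠ 0 ∧ ∀ g, conjDual M g φ = (ρ g : ℂ) • φ := by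
  obtain ⟨f, hf, hnot⟩ := (nontrivial_H1_iff ρ).1 hH
  have hf1 : f 1 = 0 := by simpa using hf 1 1
  have hinv : ∀ g, (ρ g : ℂ) * f g⁻¹ + f g = 0 := fun g => by rw [← hf, mul_inv_cancel, hf1]
  have hMmul : ∀ x ∈ M, ∀ g, f (x * g) = f g + f x := fun x hx g => by
    rw [hf, hρ x hx]; simp
  let φ : Additive M →+ ℂ :=
    { toFun := fun x => f (Additive.toMul x : M)
      map_zero' := hf1
      map_add' := fun x y => (hMmul _ (Additive.toMul x).2 _).trans (add_comm _ _) }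
  refine ⟨φ, fun h0 => ?_, fun g => ?_⟩
  · obtain ⟨a, ha⟩ : ∃ a, ρ a ≠ 1 := by
      by_contra! h
      exact hne (MonoidHom.ext h)
    have ha' : (ρ a : ℂ) - 1 ≠ 0 := sub_ne_zero.2 fun h => ha (Units.ext h)
    refine hnot ⟨f a / (ρ a - 1), fun g => ?_⟩
    have hc : ⁅a, g⁆ ∈ M :=
      hM (Subgroup.commutator_mem_commutator (Subgroup.mem_top a) (Subgroup.mem_top g))
    have h1 : f ⁅a, g⁆ = 0 := DFunLike.congr_fun h0 (Additive.ofMul (⟨_, hc⟩ : M))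
    have h2 : f (a * g) = f (g * a) := by
      have : a * g = ⁅a, g⁆ * (g * a) := by simp [commutatorElement_def, mul_assoc]
      rw [this, hMmul _ hc, h1, add_zero]
    rw [hf, hf] at h2
    field_simp
    linear_combination h2
  · refine AddMonoidHom.ext fun x => ?_
    induction x with
    | ofMul x =>
      rw [conjDual_apply]
      change f (MulAut.conjNormal g x : M) = ρ g * f x
      rw [MulAut.conjNormal_apply, hf, hf, map_mul, hρ _ x.2]
      push_cast
      linear_combination hinv g

/-- A nonzero `ρ`-equivariant homomorphism `M → ℂ` extends to a non-coboundary cocycle when `ρ` is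
nontrivial. -/
theorem nontrivial_H1_of_equivariant_hom {G : Type} [Group G] (M : Subgroup G) [M.Normal]
    (hM : commutator G ≤ M) (ρ : G →* ℂˣ) (hρ : ∀ x ∈ M, ρ x = 1) (hne : ρ ≠ 1)
    (φ : Additive M →+ ℂ) (hφ0 : φ ≠ 0) (hφ : ∀ g, conjDual M g φ = (ρ g : ℂ) • φ) :
    Nontrivial (groupCohomology.H1 (Rep.of (charRep ρ))) := by
  obtain ⟨a, ha⟩ : ∃ a, ρ a ≠ 1 := by
    by_contra! h
    exact hne (MonoidHom.ext h)
  have ha' : (ρ a : ℂ) - 1 ≠ 0 := sub_ne_zero.2 fun h => ha (Units.ext h)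
  have hc : ∀ g, ⁅a, g⁆ ∈ M := fun g =>
    hM (Subgroup.commutator_mem_commutator (Subgroup.mem_top a) (Subgroup.mem_top g))
  have hφ' : ∀ g (x : M), φ (Additive.ofMul (MulAut.conjNormal g x))
      = ρ g * φ (Additive.ofMul x) := fun g x => by
    rw [← conjDual_apply, hφ]; rfl
  refine (nontrivial_H1_iff ρ).2
    ⟨fun g => φ (Additive.ofMul ⟨⁅a, g⁆, hc g⟩) / (ρ a - 1), fun g h => ?_, ?_⟩
  · have : (⟨⁅a, g * h⁆, hc _⟩ : M) = ⟨⁅a, g⁆, hc g⟩ * MulAut.conjNormal g ⟨⁅a, h⁆, hc h⟩ :=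
      Subtype.ext (by simp [commutatorElement_def, mul_assoc])
    simp only [this, ofMul_mul, map_add, hφ']
    ring
  · rintro ⟨c, hcob⟩
    refine hφ0 (AddMonoidHom.ext fun x => ?_)
    induction x with
    | ofMul x =>
      have h1 := hcob x
      have h2 : (⟨⁅a, (x : G)⁆, hc x⟩ : M) = MulAut.conjNormal a x * x⁻¹ :=
        Subtype.ext (by simp [commutatorElement_def])
      simp only [h2, ofMul_mul, ofMul_inv, map_add, map_neg, hφ', hρ _ x.2] at h1
      rw [div_eq_iff ha'] at h1
      have h3 : ((ρ a : ℂ) - 1) * φ (Additive.ofMul x) = 0 := by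
        push_cast at h1
        linear_combination h1
      exact (mul_eq_zero.1 h3).resolve_left ha'

theorem MonoidHom.isOfFinOrder_of_finiteIndex_ker {G : Type} [Group G] (ρ : G →* ℂˣ)
    (K : Subgroup G) [K.FiniteIndex] (hK : ∀ g ∈ K, ρ g = 1) : IsOfFinOrder ρ := by
  refine isOfFinOrder_iff_pow_eq_one.2
    ⟨K.normalCore.index, Nat.pos_of_ne_zero Subgroup.FiniteIndex.index_ne_zero,
      MonoidHom.ext fun g => ?_⟩
  rw [MonoidHom.pow_apply, ← map_pow]
  exact hK _ (K.normalCore_le (Subgroup.pow_index_mem _ g))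

theorem MonoidHom.finiteIndex_ker_of_isOfFinOrder {G : Type} [Group G] (ρ : G →* ℂˣ)
    (h : IsOfFinOrder ρ) : ρ.ker.FiniteIndex := by
  obtain ⟨n, hn, hρ⟩ := isOfFinOrder_iff_pow_eq_one.1 h
  have : NeZero n := ⟨hn.ne'⟩
  have hle : (ρ.range : Set ℂˣ) ⊆ rootsOfUnity n ℂ := by
    rintro _ ⟨g, rfl⟩
    exact (mem_rootsOfUnity _ _).2 (DFunLike.congr_fun hρ g)
  have hfin : Finite (rootsOfUnity n ℂ) := inferInstance
  have : Finite ρ.range := Set.Finite.subset (s := (rootsOfUnity n ℂ : Set ℂˣ)) hfin hle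
  exact Subgroup.finiteIndex_ker ρ

theorem exists_unipotent_iff_forall_isOfFinOrder {G : Type} [Group G] (M : Subgroup G) [M.Normal]
    (hM : commutator G ≤ M) [FiniteDimensional ℂ (Additive M →+ ℂ)] :
    (∃ K : Subgroup G, K.FiniteIndex ∧ ∃ m : ℕ, ∀ g ∈ K, ∀ x ∈ M, ∃ k : ℕ, 0 < k ∧
        ((fun y => g * y * g⁻¹ * y⁻¹)^[m] x) ^ k ∈ ⁅M, M⁆) ↔
      ∀ ρ : G →* ℂˣ, Nontrivial (groupCohomology.H1 (Rep.of (charRep ρ))) →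
        (∀ x ∈ M, ρ x = 1) → IsOfFinOrder ρ := by
  constructor
  · rintro ⟨K, hK, m, hKm⟩ ρ hH hρ
    by_cases hne : ρ = 1
    · rw [hne]
      exact IsOfFinOrder.one
    obtain ⟨φ, hφ0, hφ⟩ := exists_equivariant_hom_of_nontrivial_H1 M hM ρ hρ hne hH
    refine ρ.isOfFinOrder_of_finiteIndex_ker K fun g hg => ?_
    obtain ⟨x, hx⟩ : ∃ x : M, φ (Additive.ofMul x) ≠ 0 := by
      by_contra! h
      exact hφ0 (AddMonoidHom.ext h)
    obtain ⟨k, hk, hmem⟩ := hKm g hg x x.2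
    obtain ⟨y, hy, hyφ⟩ := map_iterate_commutator M g m x
    rw [← hy, ← M.map_subtype_commutator] at hmem
    obtain ⟨z, hz, hze⟩ := hmem
    have hz' : y ^ k ∈ commutator M := by rwa [← (Subtype.ext hze : z = y ^ k)]
    have h0 := φ.map_ofMul_eq_zero_of_mem_commutator hz'
    rw [ofMul_pow, map_nsmul, smul_eq_zero, or_iff_right hk.ne', hyφ] at h0
    have hpow : ∀ n : ℕ, ((conjDual M g - 1) ^ n) φ = ((ρ g : ℂ) - 1) ^ n • φ := by
      intro n
      induction n with
      | zero => simp
      | succ n ih =>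
        rw [pow_succ, Module.End.mul_apply, LinearMap.sub_apply, hφ, Module.End.one_apply,
          map_sub, map_smul, ih, pow_succ, smul_smul, ← sub_smul]
        congr 1
        ring
    rw [hpow] at h0
    have h1 : ((ρ g : ℂ) - 1) ^ m = 0 := (mul_eq_zero.1 h0).resolve_right hx
    exact Units.ext (sub_eq_zero.1 (eq_zero_of_pow_eq_zero h1))
  · intro h
    have hcomm := conjDual_commute M hM
    have hweight : ∀ (χ : G → ℂ) (φ : Additive M →+ ℂ), φ ≠ 0 →
        (∀ g, conjDual M g φ = χ g • φ) → ∃ ρ : G →* ℂˣ, (∀ g, (ρ g : ℂ) = χ g) ∧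
          ρ.ker.FiniteIndex := by
      intro χ φ hφ0 hφ
      have hinj := smul_left_injective ℂ hφ0
      have hM1 : ∀ x ∈ M, χ x = 1 := fun x hx => hinj (by
        simp only [← hφ, conjDual_of_mem M hx, one_smul, Module.End.one_apply])
      let χ' : G →* ℂ :=
        { toFun := χ
          map_one' := hM1 1 M.one_mem
          map_mul' := fun g h => hinj (by
            simp only [← hφ, conjDual_mul, Module.End.mul_apply]
            rw [hφ g, map_smul, hφ h, smul_smul]) }
      let ρ : G →* ℂˣ := χ'.toHomUnits
      have hρ : ∀ g, (ρ g : ℂ) = χ g := fun g => rfl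
      have hρM : ∀ x ∈ M, ρ x = 1 := fun x hx => Units.ext (hM1 x hx)
      refine ⟨ρ, hρ, ρ.finiteIndex_ker_of_isOfFinOrder ?_⟩
      by_cases hne : ρ = 1
      · rw [hne]
        exact IsOfFinOrder.one
      · exact h ρ (nontrivial_H1_of_equivariant_hom M hM ρ hρM hne φ hφ0 hφ) hρM
    have hfin := Module.End.finite_joint_eigenvalues (conjDual M) hcomm
    set X : Set (G → ℂ) :=
      {χ | ∃ φ : Additive M →+ ℂ, φ ≠ 0 ∧ ∀ g, conjDual M g φ = χ g • φ}
    choose ρ hρ hρK using fun χ : X => hweight χ χ.2.choose χ.2.choose_spec.1 χ.2.choose_spec.2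
    have := hfin.to_subtype
    refine ⟨⨅ χ : X, (ρ χ).ker, Subgroup.finiteIndex_iInf hρK,
      finrank ℂ (Additive M →+ ℂ), fun g hg x hx => ?_⟩
    have hnil := Module.End.sub_one_pow_finrank_eq_zero (conjDual M g) fun c hc => by
      obtain ⟨φ, hφE, hφ0, χ, hχ⟩ := Module.End.exists_joint_eigenvector (conjDual M) hcomm
        ((conjDual M g).eigenspace c) hc fun i v hv => by
          rw [Module.End.mem_eigenspace_iff] at hv ⊢
          rw [← Module.End.mul_apply, (hcomm g i).eq, Module.End.mul_apply, hv, map_smul]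
      have h1 : c • φ = χ g • φ := by rw [← hχ g, Module.End.mem_eigenspace_iff.1 hφE]
      have h2 : c = χ g := smul_left_injective ℂ hφ0 h1
      have h3 : ρ ⟨χ, φ, hφ0, hχ⟩ g = 1 := Subgroup.mem_iInf.1 hg _
      exact h2.trans ((hρ ⟨χ, φ, hφ0, hχ⟩ g).symm.trans (by rw [h3, Units.val_one]))
    obtain ⟨y, hy, hyφ⟩ := map_iterate_commutator M g (finrank ℂ (Additive M →+ ℂ)) ⟨x, hx⟩
    obtain ⟨k, hk, hmem⟩ := exists_pow_mem_commutator_of_forall_hom y fun φ => by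
      rw [hyφ, hnil]; rfl
    refine ⟨k, hk, ?_⟩
    change ((fun y => g * y * g⁻¹ * y⁻¹)^[_] ((⟨x, hx⟩ : M) : G)) ^ k ∈ _
    rw [← hy, ← M.map_subtype_commutator]
    exact ⟨_, hmem, by simp⟩

theorem Subgroup.coe_iterate_commutator {Γ : Type} [Group Γ] (H : Subgroup Γ) (g x : H) (m : ℕ) :
    (((fun y => g * y * g⁻¹ * y⁻¹)^[m] x : H) : Γ)
      = (fun y => (g : Γ) * y * (g : Γ)⁻¹ * y⁻¹)^[m] (x : Γ) := by
  induction m with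
  | zero => rfl
  | succ m ih =>
    rw [Function.iterate_succ_apply', Function.iterate_succ_apply', ← ih]
    rfl

end

/-- Let `Γ` be a finitely generated group, `Γ' ⊆ Γ` of finite index,
`N = Γ' ∩ DΓ`, and suppose `V = N^{ab} ⊗ ℚ` is finite dimensional.  Then `Γ'`
acts quasiunipotently on `V` by conjugation if and only if every character in
`Σ¹(Γ') ∩ image(Hom(Γ, ℂ*) → Hom(Γ', ℂ*))` is torsion, where
`Σ¹(Γ') = {ρ : H¹(Γ', ℂ_ρ) ≠ 0}`.  (Unipotency of the conjugation action of
`γ` on `V = N^{ab} ⊗ ℚ` is expressed by iterated commutators with `γ` landing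
in `[N,N]` up to torsion.) -/
theorem statement14 {Γ : Type} [Group Γ] (hfg : Group.FG Γ)
    (Γ' : Subgroup Γ) [Γ'.FiniteIndex]
    (hV : ∃ r : ℕ, QuotRankLe (Γ' ⊓ commutator Γ)
      ⁅(Γ' ⊓ commutator Γ : Subgroup Γ), Γ' ⊓ commutator Γ⁆ r) :
    (∃ Γ'' : Subgroup Γ, Γ'' ≤ Γ' ∧ (Γ''.subgroupOf Γ').FiniteIndex ∧
      ∃ m : ℕ, ∀ γ ∈ Γ'', ∀ x ∈ Γ' ⊓ commutator Γ, ∃ k : ℕ, 0 < k ∧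
        ((fun y => γ * y * γ⁻¹ * y⁻¹)^[m] x) ^ k ∈
          ⁅(Γ' ⊓ commutator Γ : Subgroup Γ), Γ' ⊓ commutator Γ⁆) ↔
    (∀ ρ : ↥Γ' →* ℂˣ,
      Nontrivial (groupCohomology.H1 (Rep.of (charRep ρ))) →
      (∃ ρ' : Γ →* ℂˣ, ∀ γ : ↥Γ', ρ' ↑γ = ρ γ) →
      IsOfFinOrder ρ) := by
  set N : Subgroup Γ := Γ' ⊓ commutator Γ with hN
  let M : Subgroup Γ' := (commutator Γ).subgroupOf Γ'
  have hM : M.map Γ'.subtype = N := by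
    rw [Subgroup.subgroupOf_map_subtype, inf_comm]
  have hmemM : ∀ x : Γ', x ∈ M ↔ (x : Γ) ∈ commutator Γ := fun x => Subgroup.mem_subgroupOf
  have hmemN : ∀ x : Γ', x ∈ M ↔ (x : Γ) ∈ N := fun x => by
    rw [hmemM, hN, Subgroup.mem_inf, and_iff_right x.2]
  have hmemC : ∀ x : Γ', x ∈ ⁅M, M⁆ ↔ (x : Γ) ∈ ⁅N, N⁆ := fun x => by
    rw [← hM, ← Subgroup.map_commutator]
    exact (Subgroup.mem_map_iff_mem Γ'.subtype_injective).symm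
  have hcomm : commutator Γ' ≤ M := by
    refine Subgroup.map_le_iff_le_comap.1 ?_
    rw [Subgroup.map_subtype_commutator]
    exact Subgroup.commutator_mono le_top le_top
  obtain ⟨r, hr⟩ := hV
  have hr' : QuotRankLe M ⁅M, M⁆ r := fun f hf => by
    obtain ⟨c, hc0, hc⟩ := hr (fun j => f j) fun j => (hmemN _).1 (hf j)
    refine ⟨c, hc0, (hmemC _).2 ?_⟩
    rw [← Γ'.subtype_apply, map_list_prod, List.map_ofFn]
    exact hc
  have := finiteDimensional_hom_of_quotRankLe M r hr'
  have hext : ∀ ρ : Γ' →* ℂˣ,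
      (∃ ρ' : Γ →* ℂˣ, ∀ γ : Γ', ρ' γ = ρ γ) ↔ ∀ x ∈ M, ρ x = 1 := fun ρ => by
    constructor
    · rintro ⟨ρ', h⟩ x hx
      rw [← h]
      exact Abelianization.commutator_subset_ker ρ' ((hmemM x).1 hx)
    · exact fun h => exists_character_extension_of_trivial_on_commutator Γ' ρ
        fun x hx => h x ((hmemM x).2 hx)
  simp only [hext]
  rw [← exists_unipotent_iff_forall_isOfFinOrder M hcomm]
  constructor
  · rintro ⟨K, hK, hfin, m, h⟩
    refine ⟨K.subgroupOf Γ', hfin, m, fun g hg x hx => ?_⟩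
    obtain ⟨k, hk, hmem⟩ := h g hg x ((hmemN x).1 hx)
    refine ⟨k, hk, (hmemC _).2 ?_⟩
    rwa [Subgroup.coe_pow, Γ'.coe_iterate_commutator]
  · rintro ⟨K, hfin, m, h⟩
    refine ⟨K.map Γ'.subtype, Subgroup.map_subtype_le K, ?_, m, ?_⟩
    · rwa [Subgroup.subgroupOf, Subgroup.comap_map_eq_self_of_injective Γ'.subtype_injective]
    · rintro _ ⟨g, hg, rfl⟩ x hx
      obtain ⟨k, hk, hmem⟩ := h g hg ⟨x, hx.1⟩ ((hmemN _).2 hx)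
      refine ⟨k, hk, ?_⟩
      have := (hmemC _).1 hmem
      rwa [Subgroup.coe_pow, Γ'.coe_iterate_commutator] at this
end

section
/- If 1 → Γ' → Γ → Γ'' → 1 is a short exact sequence of solvable groups of finite rank, and n(Δ, F) denotes the supremum of dim U(G) over all homomorphisms Δ → G(F) with Zariski dense image into algebraic groups G over F, then n(Γ, F) ≤ n(Γ', F) + n(Γ'', F). -/
open Matrix

/-- A subgroup of `GL n F` is algebraic if it is the zero locus, inside
`GL n F`, of a set of polynomials in the matrix entries. -/
def IsAlgebraicSubgroup (F : Type) [Field F] (n : ℕ)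
    (G : Subgroup (GL (Fin n) F)) : Prop :=
  ∃ S : Set (MvPolynomial (Fin n × Fin n) F),
    ∀ g : GL (Fin n) F, g ∈ G ↔ ∀ p ∈ S,
      MvPolynomial.eval (fun ij => (g : Matrix (Fin n) (Fin n) F) ij.1 ij.2) p = 0

/-- An element of `GL n F` is unipotent if `g - 1` is nilpotent. -/
def IsUnipotentElt (F : Type) [Field F] (n : ℕ) (g : GL (Fin n) F) : Prop :=
  IsNilpotent ((g : Matrix (Fin n) (Fin n) F) - 1)

/-- An element of `GL n F` is semisimple if the corresponding endomorphism of
`Fⁿ` is a semisimple linear map. -/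
def IsSemisimpleElt (F : Type) [Field F] (n : ℕ) (g : GL (Fin n) F) : Prop :=
  Module.End.IsSemisimple (Matrix.toLin' (g : Matrix (Fin n) (Fin n) F))

/-- An algebraic subgroup is connected if it has no proper algebraic subgroup
of finite index. -/
def IsConnectedAlgSubgroup (F : Type) [Field F] (n : ℕ)
    (G : Subgroup (GL (Fin n) F)) : Prop :=
  IsAlgebraicSubgroup F n G ∧
  ∀ H : Subgroup (GL (Fin n) F), IsAlgebraicSubgroup F n H → H ≤ G →
    (H.subgroupOf G).FiniteIndex → H = G

/-- The truncated logarithm of a matrix; on unipotent elements of `GL n F`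
(char `F` = 0) this is the usual logarithm, with values in the Lie algebra. -/
noncomputable def matLog (F : Type) [Field F] (n : ℕ) (g : GL (Fin n) F) :
    Matrix (Fin n) (Fin n) F :=
  ∑ k ∈ Finset.Icc 1 n,
    ((-1 : F) ^ (k + 1) / (k : F)) • ((g : Matrix (Fin n) (Fin n) F) - 1) ^ k

/-- The dimension of a unipotent subgroup `U` of `GL n F` (char 0): the
dimension of the `F`-linear span of the logarithms of its elements. -/
noncomputable def unipDim (F : Type) [Field F] (n : ℕ)
    (U : Subgroup (GL (Fin n) F)) : ℕ :=
  Module.finrank F (Submodule.span F (matLog F n '' (U : Set (GL (Fin n) F))))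

/-- `nRankLe F Δ k` says that `n(Δ, F) ≤ k`: for every homomorphism
`f : Δ → G(F)` with Zariski dense image into (the `F`-points of) a linear
algebraic group `G` over `F`, the unipotent radical of `G` (here: the subgroup
of all unipotent elements of `G`) has dimension at most `k`. -/
def nRankLe (F : Type) [Field F] (Δ : Type) [Group Δ] (k : ℕ) : Prop :=
  ∀ (n : ℕ) (G U : Subgroup (GL (Fin n) F)) (f : Δ →* GL (Fin n) F),
    IsAlgebraicSubgroup F n G → (∀ δ, f δ ∈ G) →
    (∀ H : Subgroup (GL (Fin n) F), IsAlgebraicSubgroup F n H →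
      (∀ δ, f δ ∈ H) → G ≤ H) →
    U ≤ G → (∀ u ∈ U, IsUnipotentElt F n u) →
    (∀ g ∈ G, IsUnipotentElt F n g → g ∈ U) →
    unipDim F n U ≤ k
open scoped commutatorElement

/-- The evaluation of a polynomial in matrix entries at a matrix. -/
noncomputable def evalMat {F : Type} [Field F] {n : ℕ} (A : Matrix (Fin n) (Fin n) F) :
    MvPolynomial (Fin n × Fin n) F →+* F :=
  MvPolynomial.eval (fun ij => A ij.1 ij.2)

section RegularFunctions

variable {F : Type} [Field F] {n : ℕ}

/-- The algebra of regular functions on `GL n F`: quotients of polynomials in the entries by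
powers of the determinant. -/
noncomputable def regularFun (F : Type) [Field F] (n : ℕ) : Subalgebra F (GL (Fin n) F → F) where
  carrier := {φ | ∃ (k : ℕ) (p : MvPolynomial (Fin n × Fin n) F),
    ∀ g : GL (Fin n) F, φ g * (g : Matrix (Fin n) (Fin n) F).det ^ k = evalMat g p}
  mul_mem' := by
    rintro φ ψ ⟨k, p, hp⟩ ⟨l, q, hq⟩
    refine ⟨k + l, p * q, fun g => ?_⟩
    rw [map_mul, ← hp, ← hq, Pi.mul_apply, pow_add]
    ring
  add_mem' := by
    rintro φ ψ ⟨k, p, hp⟩ ⟨l, q, hq⟩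
    let d : MvPolynomial (Fin n × Fin n) F :=
      (Matrix.of fun i j => MvPolynomial.X (i, j) : Matrix (Fin n) (Fin n) _).det
    have hd : ∀ g : GL (Fin n) F, evalMat g d = (g : Matrix (Fin n) (Fin n) F).det := by
      intro g
      simp only [d, RingHom.map_det]
      congr 1
      ext i j
      simp [evalMat]
    refine ⟨k + l, p * d ^ l + q * d ^ k, fun g => ?_⟩
    rw [map_add, map_mul, map_mul, map_pow, map_pow, ← hp, ← hq, hd, Pi.add_apply, pow_add]
    ring
  algebraMap_mem' := fun c => ⟨0, MvPolynomial.C c, fun g => by simp [evalMat]⟩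

theorem entry_mem_regularFun (i j : Fin n) :
    (fun g : GL (Fin n) F => (g : Matrix (Fin n) (Fin n) F) i j) ∈ regularFun F n :=
  ⟨0, MvPolynomial.X (i, j), fun g => by simp [evalMat]⟩

theorem inv_entry_mem_regularFun (i j : Fin n) :
    (fun g : GL (Fin n) F => ((g⁻¹ : GL (Fin n) F) : Matrix (Fin n) (Fin n) F) i j) ∈
      regularFun F n := by
  refine ⟨1, (Matrix.of fun i j => MvPolynomial.X (i, j) :
    Matrix (Fin n) (Fin n) (MvPolynomial (Fin n × Fin n) F)).adjugate i j, fun g => ?_⟩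
  have h : evalMat (g : Matrix (Fin n) (Fin n) F) ((Matrix.of fun i j => MvPolynomial.X (i, j) :
      Matrix (Fin n) (Fin n) (MvPolynomial (Fin n × Fin n) F)).adjugate i j) =
      (g : Matrix (Fin n) (Fin n) F).adjugate i j := by
    have := RingHom.map_adjugate (evalMat (g : Matrix (Fin n) (Fin n) F))
      (Matrix.of fun i j => MvPolynomial.X (i, j) :
      Matrix (Fin n) (Fin n) (MvPolynomial (Fin n × Fin n) F))
    have h2 := congrFun (congrFun this i) j
    rw [RingHom.mapMatrix_apply, Matrix.map_apply] at h2
    rw [h2]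
    congr 2
    ext i j
    simp [evalMat]
  change ((g⁻¹ : GL (Fin n) F) : Matrix (Fin n) (Fin n) F) i j *
    (g : Matrix (Fin n) (Fin n) F).det ^ 1 = _
  rw [h, Matrix.coe_units_inv, Matrix.inv_def, Matrix.smul_apply, pow_one, smul_eq_mul,
    mul_right_comm, Ring.inverse_mul_cancel _ ((Matrix.isUnit_iff_isUnit_det _).1 g.isUnit),
    one_mul]

/-- Regular functions may be substituted in a polynomial. -/
theorem evalMat_mem_regularFun (p : MvPolynomial (Fin n × Fin n) F) {m : ℕ}
    {a : GL (Fin m) F → Matrix (Fin n) (Fin n) F}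
    (ha : ∀ i j, (fun g => a g i j) ∈ regularFun F m) :
    (fun g => evalMat (a g) p) ∈ regularFun F m := by
  induction p using MvPolynomial.induction_on with
  | C c =>
    simp only [evalMat, MvPolynomial.eval_C]
    exact (regularFun F m).algebraMap_mem c
  | add p q hp hq =>
    simp only [map_add]
    exact (regularFun F m).add_mem hp hq
  | mul_X p i hp =>
    simp only [map_mul]
    refine (regularFun F m).mul_mem hp ?_
    simpa [evalMat] using ha i.1 i.2

theorem mul_left_entry_mem_regularFun (a : Matrix (Fin n) (Fin n) F) (i j : Fin n) :
    (fun g : GL (Fin n) F => (a * (g : Matrix (Fin n) (Fin n) F)) i j) ∈ regularFun F n := by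
  have : (fun g : GL (Fin n) F => (a * (g : Matrix (Fin n) (Fin n) F)) i j) =
      ∑ k, a i k • fun g : GL (Fin n) F => (g : Matrix (Fin n) (Fin n) F) k j := by
    ext g; simp [Matrix.mul_apply]
  rw [this]
  exact sum_mem fun k _ => (regularFun F n).smul_mem (entry_mem_regularFun k j) _

theorem mul_entry_mem_regularFun {m : ℕ} {a b : GL (Fin m) F → Matrix (Fin n) (Fin n) F}
    (ha : ∀ i j, (fun g => a g i j) ∈ regularFun F m)
    (hb : ∀ i j, (fun g => b g i j) ∈ regularFun F m) (i j : Fin n) :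
    (fun g => (a g * b g) i j) ∈ regularFun F m := by
  have : (fun g => (a g * b g) i j) = ∑ k, (fun g => a g i k) * fun g => b g k j := by
    ext g; simp [Matrix.mul_apply]
  rw [this]
  exact sum_mem fun k _ => (regularFun F m).mul_mem (ha i k) (hb k j)

theorem const_mem_regularFun (c : F) : (fun _ : GL (Fin n) F => c) ∈ regularFun F n :=
  (regularFun F n).algebraMap_mem c

theorem comp_inv_mem_regularFun {φ : GL (Fin n) F → F} (h : φ ∈ regularFun F n) :
    (fun g => φ g⁻¹) ∈ regularFun F n := by
  obtain ⟨k, p, hp⟩ := h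
  have h1 := evalMat_mem_regularFun p (a := fun g : GL (Fin n) F =>
    ((g⁻¹ : GL (Fin n) F) : Matrix (Fin n) (Fin n) F)) inv_entry_mem_regularFun
  have h2 : (fun g : GL (Fin n) F => (g : Matrix (Fin n) (Fin n) F).det) ∈ regularFun F n := by
    simp only [Matrix.det_apply]
    have : (fun g : GL (Fin n) F => ∑ σ : Equiv.Perm (Fin n),
        Equiv.Perm.sign σ • ∏ i, (g : Matrix (Fin n) (Fin n) F) (σ i) i) =
        ∑ σ : Equiv.Perm (Fin n), (Equiv.Perm.sign σ : ℤ) •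
          ∏ i, fun g : GL (Fin n) F => (g : Matrix (Fin n) (Fin n) F) (σ i) i := by
      ext g
      simp [Units.smul_def]
    rw [this]
    exact sum_mem fun σ _ => zsmul_mem
      ((regularFun F n).prod_mem fun i _ => entry_mem_regularFun _ _) _
  convert (regularFun F n).mul_mem h1 ((regularFun F n).pow_mem h2 k) using 1
  ext g
  rw [Pi.mul_apply, Pi.pow_apply, ← hp, mul_assoc, ← mul_pow, ← Matrix.det_mul, ← Units.val_mul,
    inv_mul_cancel]
  simp

end RegularFunctions

section ZariskiClosure

variable {F : Type} [Field F] {n : ℕ}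

theorem regular_vanish_of_poly_vanish (S : Set (GL (Fin n) F)) {g : GL (Fin n) F}
    (hg : ∀ p : MvPolynomial (Fin n × Fin n) F,
      (∀ h ∈ S, evalMat (h : Matrix (Fin n) (Fin n) F) p = 0) →
      evalMat (g : Matrix (Fin n) (Fin n) F) p = 0)
    {φ : GL (Fin n) F → F} (hφ : φ ∈ regularFun F n) (h0 : ∀ h ∈ S, φ h = 0) : φ g = 0 := by
  obtain ⟨k, p, hp⟩ := hφ
  have h1 := hg p fun h hh => by rw [← hp, h0 h hh, zero_mul]
  rw [← hp] at h1
  exact (mul_eq_zero.1 h1).resolve_right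
    (pow_ne_zero _ ((Matrix.isUnit_iff_isUnit_det _).1 g.isUnit).ne_zero)

/-- The Zariski closure of a subgroup of `GL n F`. -/
noncomputable def zariskiClosure (H : Subgroup (GL (Fin n) F)) : Subgroup (GL (Fin n) F) where
  carrier := {g | ∀ p : MvPolynomial (Fin n × Fin n) F,
      (∀ h ∈ H, evalMat (h : Matrix (Fin n) (Fin n) F) p = 0) →
      evalMat (g : Matrix (Fin n) (Fin n) F) p = 0}
  one_mem' := fun p hp => hp 1 H.one_mem
  inv_mem' := by
    intro g hg p hp
    exact regular_vanish_of_poly_vanish (H : Set (GL (Fin n) F)) (g := g) hg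
      (comp_inv_mem_regularFun (evalMat_mem_regularFun p entry_mem_regularFun))
      fun h hh => hp _ (H.inv_mem hh)
  mul_mem' := by
    intro a b ha hb p hp
    have key : ∀ x ∈ H, evalMat ((x * b : GL (Fin n) F) : Matrix (Fin n) (Fin n) F) p = 0 := by
      intro x hx
      refine regular_vanish_of_poly_vanish (H : Set (GL (Fin n) F)) (g := b) hb
        (φ := fun g => evalMat ((x * g : GL (Fin n) F) : Matrix (Fin n) (Fin n) F) p) ?_
        fun h hh => hp _ (H.mul_mem hx hh)
      exact evalMat_mem_regularFun p fun i j => mul_left_entry_mem_regularFun _ i j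
    refine regular_vanish_of_poly_vanish (H : Set (GL (Fin n) F)) (g := a) ha
      (φ := fun g => evalMat ((g * b : GL (Fin n) F) : Matrix (Fin n) (Fin n) F) p) ?_ key
    exact evalMat_mem_regularFun p fun i j =>
      mul_entry_mem_regularFun entry_mem_regularFun
        (b := fun _ => (b : Matrix (Fin n) (Fin n) F)) (fun k l => const_mem_regularFun _) i j

theorem regular_vanish {H : Subgroup (GL (Fin n) F)} {φ : GL (Fin n) F → F}
    (hφ : φ ∈ regularFun F n) (h0 : ∀ h ∈ H, φ h = 0) {g : GL (Fin n) F}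
    (hg : g ∈ zariskiClosure H) : φ g = 0 :=
  regular_vanish_of_poly_vanish (H : Set (GL (Fin n) F)) (g := g) hg hφ h0

theorem le_zariskiClosure (H : Subgroup (GL (Fin n) F)) : H ≤ zariskiClosure H :=
  fun _ hg _ hp => hp _ hg

theorem isAlgebraicSubgroup_zariskiClosure (H : Subgroup (GL (Fin n) F)) :
    IsAlgebraicSubgroup F n (zariskiClosure H) :=
  ⟨{p | ∀ h ∈ H, evalMat (h : Matrix (Fin n) (Fin n) F) p = 0}, fun _ => Iff.rfl⟩

theorem zariskiClosure_le {H G : Subgroup (GL (Fin n) F)} (hG : IsAlgebraicSubgroup F n G)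
    (h : H ≤ G) : zariskiClosure H ≤ G := by
  obtain ⟨S, hS⟩ := hG
  exact fun g hg => (hS g).2 fun p hp => hg p fun x hx => (hS x).1 (h hx) p hp

theorem zariskiClosure_mono {H K : Subgroup (GL (Fin n) F)} (h : H ≤ K) :
    zariskiClosure H ≤ zariskiClosure K :=
  zariskiClosure_le (isAlgebraicSubgroup_zariskiClosure K) (h.trans (le_zariskiClosure K))

theorem commutator_zariskiClosure_le (A B : Subgroup (GL (Fin n) F)) :
    ⁅zariskiClosure A, zariskiClosure B⁆ ≤ zariskiClosure ⁅A, B⁆ := by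
  rw [Subgroup.commutator_le]
  intro a ha b hb p hp
  have inv := inv_entry_mem_regularFun (F := F) (n := n)
  have ent := entry_mem_regularFun (F := F) (n := n)
  have const : ∀ (c : Matrix (Fin n) (Fin n) F) (i j : Fin n),
      (fun _ : GL (Fin n) F => c i j) ∈ regularFun F n := fun c i j => const_mem_regularFun _
  refine regular_vanish (H := A)
    (φ := fun g => evalMat ((⁅g, b⁆ : GL (Fin n) F) : Matrix (Fin n) (Fin n) F) p) ?_ ?_ ha
  · simp only [commutatorElement_def, Units.val_mul]
    exact evalMat_mem_regularFun p (mul_entry_mem_regularFun (mul_entry_mem_regularFun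
      (mul_entry_mem_regularFun ent (const _)) inv) (const _))
  · intro x hx
    refine regular_vanish (H := B)
      (φ := fun g => evalMat ((⁅x, g⁆ : GL (Fin n) F) : Matrix (Fin n) (Fin n) F) p) ?_ ?_ hb
    · simp only [commutatorElement_def, Units.val_mul]
      exact evalMat_mem_regularFun p (mul_entry_mem_regularFun (mul_entry_mem_regularFun
        (mul_entry_mem_regularFun (const _) ent) (const _)) inv)
    · exact fun y hy => hp _ (Subgroup.commutator_mem_commutator hx hy)

theorem zariskiClosure_bot : zariskiClosure (⊥ : Subgroup (GL (Fin n) F)) = ⊥ := by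
  rw [eq_bot_iff]
  intro g hg
  rw [Subgroup.mem_bot]
  ext i j
  have := regular_vanish (φ := fun g : GL (Fin n) F =>
    (g : Matrix (Fin n) (Fin n) F) i j - (1 : Matrix (Fin n) (Fin n) F) i j)
    ((regularFun F n).sub_mem (entry_mem_regularFun i j) (const_mem_regularFun _))
    (fun h hh => by rw [Subgroup.mem_bot.1 hh]; simp) hg
  simpa using sub_eq_zero.1 this

theorem isSolvable_zariskiClosure_range {Δ : Type} [Group Δ] [hs : Group.IsSolvable Δ]
    (ρ : Δ →* GL (Fin n) F) : Group.IsSolvable (zariskiClosure ρ.range) := by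
  obtain ⟨d, hd⟩ := hs.solvable
  refine ⟨⟨d, ?_⟩⟩
  have key : ∀ k, (derivedSeries (zariskiClosure ρ.range) k).map (zariskiClosure ρ.range).subtype ≤
      zariskiClosure ((derivedSeries Δ k).map ρ) := by
    intro k
    induction k with
    | zero =>
      rw [derivedSeries_zero, derivedSeries_zero, ← MonoidHom.range_eq_map,
        ← MonoidHom.range_eq_map, Subgroup.range_subtype]
    | succ k ih =>
      rw [derivedSeries_succ, derivedSeries_succ, Subgroup.map_commutator,
        Subgroup.map_commutator]
      exact (Subgroup.commutator_mono ih ih).trans (commutator_zariskiClosure_le _ _)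
  have h := key d
  rw [hd, Subgroup.map_bot, zariskiClosure_bot, le_bot_iff] at h
  exact (Subgroup.map_eq_bot_iff_of_injective _ (Subgroup.subtype_injective _)).1 h

theorem zariskiClosure_conj_mem {A B : Subgroup (GL (Fin n) F)} (h : ⁅A, B⁆ ≤ B)
    {a b : GL (Fin n) F} (ha : a ∈ zariskiClosure A) (hb : b ∈ zariskiClosure B) :
    a * b * a⁻¹ ∈ zariskiClosure B := by
  have h1 : ⁅a, b⁆ ∈ zariskiClosure B := zariskiClosure_mono h
    (commutator_zariskiClosure_le A B (Subgroup.commutator_mem_commutator ha hb))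
  simpa [commutatorElement_def] using mul_mem h1 hb

end ZariskiClosure

theorem SolvableFiniteRank.isSolvable {Γ : Type} [Group Γ] (h : SolvableFiniteRank Γ) :
    Group.IsSolvable Γ := by
  obtain ⟨r, m, s, d, h0, hm, hs, -⟩ := h
  refine ⟨⟨m + 1, ?_⟩⟩
  rw [← le_bot_iff, ← hm]
  have : ∀ k ≤ m + 1, derivedSeries Γ k ≤ s k := by
    intro k
    induction k with
    | zero => simp [h0]
    | succ k ih =>
      intro hk
      rw [derivedSeries_succ]
      exact (Subgroup.commutator_mono (ih (by omega)) (ih (by omega))).trans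
        (hs k (by omega)).2.1
  exact this _ le_rfl

section BinomialPolynomial

/-- The polynomial `t ↦ t (t - 1) ⋯ (t - j + 1) / j!`. -/
noncomputable def binomPoly (K : Type) [Field K] (j : ℕ) : Polynomial K :=
  Polynomial.C (j.factorial : K)⁻¹ * descPochhammer K j

theorem binomPoly_eval_natCast {K : Type} [Field K] [CharZero K] (j k : ℕ) :
    (binomPoly K j).eval (k : K) = (k.choose j : K) := by
  rw [binomPoly, Polynomial.eval_mul, Polynomial.eval_C, descPochhammer_eval_eq_descFactorial,
    Nat.descFactorial_eq_factorial_mul_choose, Nat.cast_mul, inv_mul_cancel_left₀]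
  exact_mod_cast j.factorial_ne_zero

theorem one_add_pow_eq_sum {A : Type} [Ring A] {N : A} {m : ℕ} (hN : N ^ m = 0) (k : ℕ) :
    (1 + N) ^ k = ∑ j ∈ Finset.range m, (k.choose j) • N ^ j := by
  rw [add_comm, (Commute.one_right N).add_pow]
  simp only [one_pow, mul_one, nsmul_eq_mul, (Nat.cast_commute _ _).eq]
  rcases le_total (k + 1) m with h | h
  · refine Finset.sum_subset (Finset.range_mono h) fun j _ hj => ?_
    rw [Nat.choose_eq_zero_of_lt (by simpa using hj)]
    simp
  · symm
    refine Finset.sum_subset (Finset.range_mono h) fun j _ hj => ?_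
    rw [pow_eq_zero_of_le (by simpa using hj) hN]
    simp

/-- Matrix coefficients of powers of a unipotent element are polynomial in the exponent. -/
theorem exists_polynomial_unipotent_pow {K : Type} [Field K] [CharZero K] {A : Type} [Ring A]
    [Algebra K A] {u : A} (hu : IsNilpotent (u - 1)) (l : A →ₗ[K] K) :
    ∃ q : Polynomial K, ∀ k : ℕ, q.eval (k : K) = l (u ^ k) := by
  obtain ⟨m, hm⟩ := hu
  refine ⟨∑ j ∈ Finset.range m, Polynomial.C (l ((u - 1) ^ j)) * binomPoly K j, fun k => ?_⟩
  have h := one_add_pow_eq_sum hm k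
  rw [add_sub_cancel] at h
  rw [h, Polynomial.eval_finsetSum, map_sum]
  refine Finset.sum_congr rfl fun j _ => ?_
  rw [Polynomial.eval_mul, Polynomial.eval_C, binomPoly_eval_natCast, map_nsmul, nsmul_eq_mul,
    mul_comm]

end BinomialPolynomial

section Unipotent

theorem isNilpotent_mul_sub_one {A : Type*} [Ring A] {u v : A} (h : Commute u v)
    (hu : IsNilpotent (u - 1)) (hv : IsNilpotent (v - 1)) : IsNilpotent (u * v - 1) := by
  have e : u * v - 1 = (u - 1) * v + (v - 1) := by noncomm_ring
  have h1 : Commute (u - 1) v := h.sub_left (Commute.one_left v)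
  rw [e]
  refine Commute.isNilpotent_add ?_ (h1.isNilpotent_mul_right hu) hv
  exact ((h1.sub_right (Commute.one_right _)).mul_left
    ((Commute.refl v).sub_right (Commute.one_right v)))

theorem isNilpotent_inv_sub_one {A : Type*} [Ring A] {u v : A} (h : u * v = 1) (h' : v * u = 1)
    (hu : IsNilpotent (u - 1)) : IsNilpotent (v - 1) := by
  have e : v - 1 = (u - 1) * (-v) := by rw [sub_mul, mul_neg, h]; noncomm_ring
  have hc : Commute (u - 1) (-v) := by
    have : Commute u v := h.trans h'.symm
    exact (this.sub_left (Commute.one_left v)).neg_right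
  rw [e]
  exact hc.isNilpotent_mul_right hu

/-- A unipotent operator which permutes eigenvectors of an operator, up to changing the
eigenvalue, preserves the eigenvalue. -/
theorem unipotent_preserves_eigenvalue {K : Type} [Field K] [CharZero K] {W : Type}
    [AddCommGroup W] [Module K W] [FiniteDimensional K W] {u a : Module.End K W}
    (hu : IsNilpotent (u - 1)) {v : W} {c : ℕ → K} (h : ∀ k, a ((u ^ k) v) = c k • (u ^ k) v)
    (hne : ∀ k, (u ^ k) v ≠ 0) (k : ℕ) : c k = c 0 := by
  have hev : ∀ k, a.HasEigenvalue (c k) := fun k =>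
    Module.End.hasEigenvalue_of_hasEigenvector
      (Module.End.hasEigenvector_iff.2 ⟨Module.End.mem_eigenspace_iff.2 (h k), hne k⟩)
  obtain ⟨μ, hμ⟩ : ∃ μ, (c ⁻¹' {μ}).Infinite := by
    have : Finite (Set.range c) :=
      (Module.End.finite_hasEigenvalue a).subset (by rintro _ ⟨k, rfl⟩; exact hev k)
    obtain ⟨⟨μ, _⟩, hμ⟩ := Finite.exists_infinite_fiber (Set.rangeFactorization c)
    refine ⟨μ, (Set.infinite_coe_iff.1 hμ).mono fun k hk => ?_⟩
    simpa [Set.rangeFactorization, Subtype.ext_iff] using hk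
  have key : ∀ k, a ((u ^ k) v) = μ • (u ^ k) v := by
    intro k
    rw [← sub_eq_zero]
    refine (Module.forall_dual_apply_eq_zero_iff K _).1 fun l => ?_
    obtain ⟨q, hq⟩ := exists_polynomial_unipotent_pow hu
      (l ∘ₗ (a - algebraMap K _ μ) ∘ₗ LinearMap.applyₗ v)
    have hq' : ∀ k : ℕ, q.eval (k : K) = l (a ((u ^ k) v) - μ • (u ^ k) v) := by
      intro k
      rw [hq]
      simp [Module.algebraMap_end_apply]
    have hq0 : q = 0 := by
      refine Polynomial.eq_zero_of_infinite_isRoot q ?_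
      refine (hμ.image (f := fun k : ℕ => (k : K)) Nat.cast_injective.injOn).mono ?_
      rintro _ ⟨k, hk, rfl⟩
      have hk' : c k = μ := hk
      simp only [Set.mem_ofPred_eq, Polynomial.IsRoot]
      rw [hq', h, hk', sub_self, map_zero]
    rw [← hq', hq0, Polynomial.eval_zero]
  have hc : ∀ k, c k = μ := fun k => by
    have := (h k).symm.trans (key k)
    exact smul_left_injective K (hne k) this
  rw [hc, hc]

end Unipotent

section CommonEigenvector

theorem exists_common_eigenvector {K : Type} [Field K] [IsAlgClosed K] {ι : Type} (n : ℕ) :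
    ∀ (W : Type) [AddCommGroup W] [Module K W] [FiniteDimensional K W] [Nontrivial W]
    (_ : Module.finrank K W ≤ n) (a : ι → Module.End K W) (_ : ∀ i j, Commute (a i) (a j)),
    ∃ (χ : ι → K) (v : W), v ≠ 0 ∧ ∀ i, a i v = χ i • v := by
  induction n with
  | zero =>
    intro W _ _ _ _ hW
    exact absurd hW (by simpa using (Module.finrank_pos (R := K) (M := W)).ne')
  | succ n ih =>
    intro W _ _ _ _ hW a ha
    by_cases hs : ∀ i, ∃ μ, (a i).eigenspace μ = ⊤
    · choose χ hχ using hs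
      obtain ⟨v, hv⟩ := exists_ne (0 : W)
      refine ⟨χ, v, hv, fun i => Module.End.mem_eigenspace_iff.1 ?_⟩
      rw [hχ i]
      trivial
    · push Not at hs
      obtain ⟨i, hi⟩ := hs
      obtain ⟨μ, hμ⟩ := Module.End.exists_eigenvalue (a i)
      have hinv : ∀ j, ∀ x ∈ (a i).eigenspace μ, a j x ∈ (a i).eigenspace μ := by
        intro j x hx
        rw [Module.End.mem_eigenspace_iff] at hx ⊢
        have := LinearMap.congr_fun (ha i j).eq x
        simp only [Module.End.mul_apply] at this
        rw [this, hx, map_smul]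
      have : Nontrivial ((a i).eigenspace μ) := Submodule.nontrivial_iff_ne_bot.2 hμ
      have hlt := Submodule.finrank_lt (hi μ)
      obtain ⟨χ, v, hv, hχ⟩ := ih ((a i).eigenspace μ) (by omega)
        (fun j => (a j).restrict (hinv j)) (fun j k => by
          ext x
          have := LinearMap.congr_fun (ha j k).eq (x : W)
          simpa using this)
      exact ⟨χ, v, by simpa using hv, fun j => by simpa using congrArg Subtype.val (hχ j)⟩

end CommonEigenvector

section SolvableUnipotent

variable {K : Type} [Field K] {H : Type} [Group H]

theorem isNilpotent_linHom_sub_one {W : Type} [AddCommGroup W] [Module K W]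
    (ρ : Representation K H W) {s : H} (hs : IsNilpotent (ρ s - 1)) :
    IsNilpotent ((ρ.linHom ρ) s - 1) := by
  have hs' : IsNilpotent (ρ s⁻¹ - 1) := isNilpotent_inv_sub_one
    (by rw [← map_mul, mul_inv_cancel, map_one]) (by rw [← map_mul, inv_mul_cancel, map_one]) hs
  have e : (ρ.linHom ρ) s = LinearMap.mulLeft K (ρ s) * LinearMap.mulRight K (ρ s⁻¹) := by
    ext T w
    simp [Representation.linHom_apply]
  rw [e]
  refine isNilpotent_mul_sub_one (LinearMap.commute_mulLeft_right _ _) ?_ ?_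
  · have : LinearMap.mulLeft K (ρ s) - 1 = LinearMap.mulLeft K (ρ s - 1) := by
      ext T w; simp
    rw [this]
    exact (LinearMap.isNilpotent_mulLeft_iff K _).2 hs
  · have : LinearMap.mulRight K (ρ s⁻¹) - 1 = LinearMap.mulRight K (ρ s⁻¹ - 1) := by
      ext T w; simp
    rw [this]
    exact (LinearMap.isNilpotent_mulRight_iff K _).2 hs'

theorem isNilpotent_subrepresentation_sub_one {W : Type} [AddCommGroup W] [Module K W]
    (ρ : Representation K H W) (M : Submodule K W) (hM : ∀ g, M ≤ M.comap (ρ g)) {s : H}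
    (hs : IsNilpotent (ρ s - 1)) : IsNilpotent (ρ.subrepresentation M hM s - 1) := by
  have hmap : Set.MapsTo (ρ s - 1 : Module.End K W) M M :=
    fun x hx => M.sub_mem (hM s hx) hx
  have := Module.End.isNilpotent.restrict hmap hs
  convert this using 1
  ext x
  rfl

variable [CharZero K] [IsAlgClosed K]

/-- An irreducible representation of a group generated by unipotents, trivial on the
`(d + 1)`-st derived subgroup: the `d`-th derived subgroup acts by scalars. -/
theorem derivedSeries_acts_by_scalars {W : Type} [AddCommGroup W] [Module K W]
    [FiniteDimensional K W] [Nontrivial W] (ρ : Representation K H W) {S : Set H}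
    (hS : Subgroup.closure S = ⊤) (hu : ∀ s ∈ S, IsNilpotent (ρ s - 1)) {d : ℕ}
    (hd : ∀ h ∈ derivedSeries H (d + 1), ρ h = 1)
    (hirr : ∀ M : Submodule K W, (∀ g, M ≤ M.comap (ρ g)) → M ≠ ⊥ → M = ⊤) :
    ∃ χ : derivedSeries H d → K, ∀ (a : derivedSeries H d) (v : W), ρ a v = χ a • v := by
  have hcomm : ∀ a b : derivedSeries H d, Commute (ρ a) (ρ b) := by
    intro a b
    have h1 := hd _ (derivedSeries_succ H d ▸ Subgroup.commutator_mem_commutator a.2 b.2)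
    have h2 : (a : H) * b = ⁅(a : H), (b : H)⁆ * (b * a) := by simp [commutatorElement_def]
    change ρ a * ρ b = ρ b * ρ a
    rw [← map_mul, ← map_mul, h2, map_mul, h1, one_mul]
  obtain ⟨χ, v, hv, hχ⟩ := exists_common_eigenvector _ W le_rfl
    (fun a : derivedSeries H d => ρ a) hcomm
  let E : Submodule K W := ⨅ a : derivedSeries H d, Module.End.eigenspace (ρ a) (χ a)
  have memE : ∀ w, w ∈ E ↔ ∀ a : derivedSeries H d, ρ a w = χ a • w := by
    intro w
    simp only [E, Submodule.mem_iInf, Module.End.mem_eigenspace_iff]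
  have hstep : ∀ s, IsNilpotent (ρ s - 1) → ∀ w ∈ E, ρ s w ∈ E := by
    intro s hs w hw
    rcases eq_or_ne w 0 with rfl | hw0
    · simp
    rw [memE] at hw ⊢
    intro a
    have hconj : ∀ k : ℕ, (s ^ k)⁻¹ * (a : H) * s ^ k ∈ derivedSeries H d := fun k => by
      simpa using (derivedSeries_normal H d).conj_mem a a.2 (s ^ k)⁻¹
    have h1 : ∀ k : ℕ, ρ a ((ρ s ^ k) w) = χ ⟨_, hconj k⟩ • (ρ s ^ k) w := by
      intro k
      have h2 := congrArg (ρ s ^ k) (hw ⟨_, hconj k⟩)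
      rw [map_smul] at h2
      rw [← h2, ← map_pow]
      simp only [← Module.End.mul_apply, ← map_mul]
      congr 2
      group
    have h3 := unipotent_preserves_eigenvalue hs h1 (fun k => by
      rw [← map_pow]
      intro h0
      have := congrArg (ρ (s ^ k)⁻¹) h0
      rw [← Module.End.mul_apply, ← map_mul, inv_mul_cancel, map_one, map_zero] at this
      exact hw0 this) 1
    have h4 := h1 1
    rw [h3, pow_one] at h4
    rw [h4]
    congr 2
    simp
  have hinv : ∀ s, IsNilpotent (ρ s - 1) → IsNilpotent (ρ s⁻¹ - 1) := fun s hs =>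
    isNilpotent_inv_sub_one (by rw [← map_mul, mul_inv_cancel, map_one])
      (by rw [← map_mul, inv_mul_cancel, map_one]) hs
  have hE : ∀ g, E ≤ E.comap (ρ g) := by
    intro g
    have hg : g ∈ Subgroup.closure S := hS ▸ Subgroup.mem_top g
    induction hg using Subgroup.closure_induction'' with
    | mem s hs => exact hstep s (hu s hs)
    | inv_mem s hs => exact hstep _ (hinv s (hu s hs))
    | one => intro w hw; rwa [Submodule.mem_comap, map_one]
    | mul x y _ _ hx hy =>
      intro w hw
      rw [Submodule.mem_comap, map_mul, Module.End.mul_apply]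
      exact hx (hy hw)
  have htop := hirr E hE fun h => hv (by simpa [h] using (memE v).2 hχ)
  exact ⟨χ, fun a w => (memE w).1 (htop ▸ Submodule.mem_top) a⟩

theorem exists_fixed_vector {S : Set H} (hS : Subgroup.closure S = ⊤) (d : ℕ) :
    ∀ (W : Type) [AddCommGroup W] [Module K W] [FiniteDimensional K W] [Nontrivial W]
    (ρ : Representation K H W) (_ : ∀ s ∈ S, IsNilpotent (ρ s - 1))
    (_ : ∀ h ∈ derivedSeries H d, ρ h = 1), ∃ v : W, v ≠ 0 ∧ ∀ h, ρ h v = v := by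
  induction d with
  | zero =>
    intro W _ _ _ _ ρ _ hd
    obtain ⟨v, hv⟩ := exists_ne (0 : W)
    exact ⟨v, hv, fun h => by rw [hd h (by simp)]; rfl⟩
  | succ d ihd =>
    suffices h : ∀ n, ∀ (W : Type) [AddCommGroup W] [Module K W] [FiniteDimensional K W]
        [Nontrivial W] (_ : Module.finrank K W ≤ n)
        (ρ : Representation K H W) (_ : ∀ s ∈ S, IsNilpotent (ρ s - 1))
        (_ : ∀ h ∈ derivedSeries H (d + 1), ρ h = 1), ∃ v : W, v ≠ 0 ∧ ∀ h, ρ h v = v by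
      intro W _ _ _ _
      exact h _ W le_rfl
    intro n
    induction n with
    | zero =>
      intro W _ _ _ _ hW
      exact absurd hW (by simpa using (Module.finrank_pos (R := K) (M := W)).ne')
    | succ n ihn =>
      intro W _ _ _ _ hW ρ hu hd
      by_cases hirr : ∀ M : Submodule K W, (∀ g, M ≤ M.comap (ρ g)) → M ≠ ⊥ → M = ⊤
      · obtain ⟨χ, hχ⟩ := derivedSeries_acts_by_scalars ρ hS hu hd hirr
        by_cases h1 : Module.finrank K W = 1
        · have hgen : ∀ g, ∀ w, ρ g w = w := by
            intro g
            have hg : g ∈ Subgroup.closure S := hS ▸ Subgroup.mem_top g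
            induction hg using Subgroup.closure_induction with
            | mem s hs =>
              obtain ⟨c, hc⟩ := (LinearMap.existsUnique_eq_smul_id_of_finrank_eq_one h1
                (ρ s - 1)).exists
              have h2 := hu s hs
              rw [hc] at h2
              obtain ⟨k, hk⟩ := h2
              obtain ⟨v, hv⟩ := exists_ne (0 : W)
              have hc0 : c = 0 := by
                rw [smul_pow, ← Module.End.one_eq_id, one_pow] at hk
                have h3 := LinearMap.congr_fun hk v
                simp only [LinearMap.smul_apply, Module.End.one_apply, LinearMap.zero_apply,
                  smul_eq_zero, hv, or_false] at h3
                exact eq_zero_of_pow_eq_zero h3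
              intro w
              rw [hc0, zero_smul, sub_eq_zero] at hc
              rw [hc]; rfl
            | one => simp
            | mul x y _ _ hx hy => intro w; rw [map_mul, Module.End.mul_apply, hy, hx]
            | inv x _ hx =>
              intro w
              conv_lhs => rw [← hx w]
              rw [← Module.End.mul_apply, ← map_mul, inv_mul_cancel, map_one]; rfl
          obtain ⟨v, hv⟩ := exists_ne (0 : W)
          exact ⟨v, hv, fun g => hgen g v⟩
        · exfalso
          let T0 : Submodule K (Module.End K W) := LinearMap.ker (LinearMap.trace K W)
          have hT0 : ∀ g, T0 ≤ T0.comap ((ρ.linHom ρ) g) := by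
            intro g T hT
            rw [Submodule.mem_comap, LinearMap.mem_ker, Representation.linHom_apply]
            rw [LinearMap.mem_ker] at hT
            rw [← Module.End.mul_eq_comp, ← Module.End.mul_eq_comp, LinearMap.trace_mul_comm,
              mul_assoc, ← map_mul, inv_mul_cancel, map_one, mul_one, hT]
          have hnt : Nontrivial T0 := by
            rw [Submodule.nontrivial_iff_ne_bot]
            intro hbot
            have h2 : Module.finrank K (Module.End K W) ≤ 1 := by
              have := LinearMap.finrank_le_finrank_of_injective (LinearMap.ker_eq_bot.1 hbot)
              simpa using this
            rw [Module.finrank_linearMap] at h2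
            have h3 := Module.finrank_pos (R := K) (M := W)
            nlinarith [show 2 ≤ Module.finrank K W by omega]
          obtain ⟨T, hT, hfix⟩ := ihd T0 ((ρ.linHom ρ).subrepresentation T0 hT0)
            (fun s hs => isNilpotent_subrepresentation_sub_one _ _ hT0
              (isNilpotent_linHom_sub_one ρ (hu s hs)))
            (fun a ha => by
              ext T w
              have ha' := (derivedSeries H d).inv_mem ha
              change ρ a ((T : Module.End K W) (ρ a⁻¹ w)) = (T : Module.End K W) w
              rw [hχ ⟨_, ha'⟩, map_smul, ← hχ ⟨_, ha'⟩, ← Module.End.mul_apply, ← map_mul,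
                mul_inv_cancel, map_one]
              rfl)
          have hcomm : ∀ g w, (T : Module.End K W) (ρ g w) = ρ g ((T : Module.End K W) w) := by
            intro g w
            have h2 : ρ g ((T : Module.End K W) (ρ g⁻¹ (ρ g w))) = (T : Module.End K W) (ρ g w) :=
              LinearMap.congr_fun (congrArg Subtype.val (hfix g)) (ρ g w)
            rw [← h2, ← Module.End.mul_apply (ρ g⁻¹), ← map_mul, inv_mul_cancel, map_one]
            rfl
          obtain ⟨μ, hμ⟩ := Module.End.exists_eigenvalue (T : Module.End K W)
          have htop := hirr ((T : Module.End K W).eigenspace μ) (fun g w hw => by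
            rw [Submodule.mem_comap, Module.End.mem_eigenspace_iff, hcomm,
              Module.End.mem_eigenspace_iff.1 hw, map_smul]) hμ
          have hTμ : (T : Module.End K W) = μ • 1 := by
            ext w
            exact Module.End.mem_eigenspace_iff.1 (htop ▸ Submodule.mem_top : w ∈ _)
          have htr : LinearMap.trace K W (T : Module.End K W) = 0 := T.2
          rw [hTμ, map_smul, LinearMap.trace_one, smul_eq_mul, mul_eq_zero] at htr
          rcases htr with h0 | h0
          · rw [h0, zero_smul] at hTμ
            exact hT (Subtype.ext hTμ)
          · exact (Module.finrank_pos (R := K) (M := W)).ne' (by exact_mod_cast h0)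
      · push Not at hirr
        obtain ⟨M, hM, hbot, htop⟩ := hirr
        have : Nontrivial M := Submodule.nontrivial_iff_ne_bot.2 hbot
        have hlt := Submodule.finrank_lt htop
        obtain ⟨v, hv, hfix⟩ := ihn M (by omega) (ρ.subrepresentation M hM)
          (fun s hs => isNilpotent_subrepresentation_sub_one _ _ hM (hu s hs))
          (fun a ha => by
            ext w
            exact LinearMap.congr_fun (hd a ha) (w : W))
        exact ⟨v, by simpa using hv, fun g => congrArg Subtype.val (hfix g)⟩

/-- A solvable group generated by unipotent operators acts unipotently. -/
theorem list_prod_sub_one_eq_zero {S : Set H} (hS : Subgroup.closure S = ⊤)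
    [hsol : Group.IsSolvable H] (n : ℕ) :
    ∀ (W : Type) [AddCommGroup W] [Module K W] [FiniteDimensional K W]
    (_ : Module.finrank K W ≤ n) (ρ : Representation K H W)
    (_ : ∀ s ∈ S, IsNilpotent (ρ s - 1)) (l : List H), l.length = n →
    (l.map fun h => ρ h - 1).prod = 0 := by
  obtain ⟨d, hd⟩ := hsol.solvable
  induction n with
  | zero =>
    intro W _ _ _ hW ρ hu l hl
    have : Subsingleton W := Module.finrank_zero_iff.1 (Nat.le_zero.1 hW)
    exact Subsingleton.elim _ _
  | succ n ih =>
    intro W _ _ _ hW ρ hu l hl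
    rcases subsingleton_or_nontrivial W with _ | _
    · exact Subsingleton.elim _ _
    obtain ⟨v, hv, hfix⟩ := exists_fixed_vector hS d W ρ hu
      (fun h hh => by rw [hd, Subgroup.mem_bot] at hh; rw [hh, map_one])
    let W1 : Submodule K W := K ∙ v
    have hW1 : ∀ w ∈ W1, ∀ g, ρ g w = w := by
      intro w hw g
      obtain ⟨c, rfl⟩ := Submodule.mem_span_singleton.1 hw
      rw [map_smul, hfix]
    have hinv : ∀ g, W1 ≤ W1.comap (ρ g) := fun g w hw => by
      rw [Submodule.mem_comap, hW1 w hw]; exact hw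
    have hrank : Module.finrank K (W ⧸ W1) ≤ n := by
      have h1 := Submodule.finrank_quotient_add_finrank W1
      have h2 : Module.finrank K W1 = 1 := finrank_span_singleton hv
      omega
    have hmk : ∀ g, W1.mkQ ∘ₗ (ρ g - 1) = (ρ.quotient W1 hinv g - 1) ∘ₗ W1.mkQ := by
      intro g; ext w; simp [Representation.quotient]
    match l, hl with
    | g :: l, hl =>
      have hl : l.length = n := by simpa using hl
      have h0 := ih (W ⧸ W1) hrank (ρ.quotient W1 hinv) (fun s hs => by
        obtain ⟨k, hk⟩ := hu s hs
        refine ⟨k, ?_⟩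
        have h1 : ∀ k : ℕ, W1.mkQ ∘ₗ ((ρ s - 1) ^ k) =
            ((ρ.quotient W1 hinv s - 1) ^ k) ∘ₗ W1.mkQ := by
          intro k
          induction k with
          | zero => rfl
          | succ k ihk =>
            rw [pow_succ, pow_succ, Module.End.mul_eq_comp, Module.End.mul_eq_comp,
              ← LinearMap.comp_assoc, ihk, LinearMap.comp_assoc, hmk, LinearMap.comp_assoc]
        have h2 := h1 k
        rw [hk, LinearMap.comp_zero] at h2
        refine LinearMap.ext fun x => ?_
        obtain ⟨w, rfl⟩ := W1.mkQ_surjective x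
        exact (LinearMap.congr_fun h2 w).symm) l hl
      have h1 : ∀ l : List H, W1.mkQ ∘ₗ (l.map fun h => ρ h - 1).prod =
          (l.map fun h => ρ.quotient W1 hinv h - 1).prod ∘ₗ W1.mkQ := by
        intro l
        induction l with
        | nil => rfl
        | cons h l ihl =>
          rw [List.map_cons, List.map_cons, List.prod_cons, List.prod_cons,
            Module.End.mul_eq_comp, Module.End.mul_eq_comp, ← LinearMap.comp_assoc, hmk,
            LinearMap.comp_assoc, ihl, LinearMap.comp_assoc]
      have h2 := h1 l
      rw [h0, LinearMap.zero_comp] at h2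
      rw [List.map_cons, List.prod_cons]
      refine LinearMap.ext fun w => ?_
      have h3 : (l.map fun h => ρ h - 1).prod w ∈ W1 := by
        rw [← W1.ker_mkQ, LinearMap.mem_ker]
        exact LinearMap.congr_fun h2 w
      rw [Module.End.mul_apply, LinearMap.sub_apply, hW1 _ h3]
      simp

end SolvableUnipotent

section MatrixGroups

variable {F : Type} [Field F] [CharZero F] {n : ℕ}

/-- In a solvable linear group generated by unipotent elements, products of `n` elements of the
form `h - 1` vanish. -/
theorem matrix_list_prod_sub_one_eq_zero (H : Subgroup (GL (Fin n) F)) [Group.IsSolvable H]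
    {S : Set H} (hS : Subgroup.closure S = ⊤)
    (hu : ∀ s ∈ S, IsUnipotentElt F n (s : GL (Fin n) F)) (l : List H) (hl : l.length = n) :
    (l.map fun h : H => ((h : GL (Fin n) F) : Matrix (Fin n) (Fin n) F) - 1).prod = 0 := by
  let K := AlgebraicClosure F
  have : CharZero K := charZero_of_injective_algebraMap (algebraMap F K).injective
  let Φ : Matrix (Fin n) (Fin n) F →+* Module.End K (Fin n → K) :=
    ((Matrix.toLinAlgEquiv' : Matrix (Fin n) (Fin n) K ≃ₐ[K] _) : _ →+* _).comp
      (algebraMap F K).mapMatrix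
  have hΦ : Function.Injective Φ :=
    (Matrix.toLinAlgEquiv' (R := K)).injective.comp
      (Matrix.map_injective (algebraMap F K).injective)
  let ρ : Representation K H (Fin n → K) :=
    (Φ : _ →* _).comp ((Units.coeHom _).comp H.subtype)
  have hρ : ∀ h : H, ρ h - 1 = Φ (((h : GL (Fin n) F) : Matrix (Fin n) (Fin n) F) - 1) := by
    intro h
    rw [map_sub, map_one]
    rfl
  have := list_prod_sub_one_eq_zero hS n (Fin n → K) (by simp) ρ
    (fun s hs => by rw [hρ]; exact (hu s hs).map Φ) l hl
  apply hΦ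
  rw [map_list_prod, List.map_map, map_zero, ← this]
  congr 1
  refine List.map_congr_left fun h _ => ?_
  rw [hρ]; rfl

theorem isUnipotentElt_of_mem_closure {G : Subgroup (GL (Fin n) F)} [hG : Group.IsSolvable G]
    {S : Set (GL (Fin n) F)} (hSG : S ⊆ G) (hS : ∀ s ∈ S, IsUnipotentElt F n s)
    {g : GL (Fin n) F} (hg : g ∈ Subgroup.closure S) : IsUnipotentElt F n g := by
  have hle : Subgroup.closure S ≤ G := (Subgroup.closure_le G).2 hSG
  have : Group.IsSolvable (Subgroup.closure S) :=
    Group.isSolvable_of_isSolvable_injective (Subgroup.inclusion_injective hle)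
  have h := matrix_list_prod_sub_one_eq_zero (Subgroup.closure S)
    (S := (Subgroup.closure S).subtype ⁻¹' S) Subgroup.closure_closure_coe_preimage
    (fun s hs => hS _ hs) (List.replicate n ⟨g, hg⟩) (by simp)
  rw [List.map_replicate, List.prod_replicate] at h
  exact ⟨n, h⟩

end MatrixGroups

section OneParameter

/-- Polynomial one-parameter subgroups of `GL n F`. -/
structure OneParam (F : Type) [Field F] (n : ℕ) where
  /-- The matrix of polynomials defining the one-parameter subgroup. -/
  poly : Matrix (Fin n) (Fin n) (Polynomial F)
  map_add' : ∀ s t : F, poly.map (Polynomial.eval (s + t)) =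
    poly.map (Polynomial.eval s) * poly.map (Polynomial.eval t)
  map_zero' : poly.map (Polynomial.eval 0) = 1

namespace OneParam

variable {F : Type} [Field F] {n : ℕ}

/-- The element of the one-parameter subgroup at time `t`. -/
noncomputable def gl (P : OneParam F n) (t : F) : GL (Fin n) F where
  val := P.poly.map (Polynomial.eval t)
  inv := P.poly.map (Polynomial.eval (-t))
  val_inv := by rw [← P.map_add', add_neg_cancel, P.map_zero']
  inv_val := by rw [← P.map_add', neg_add_cancel, P.map_zero']

theorem coe_gl (P : OneParam F n) (t : F) :
    (P.gl t : Matrix (Fin n) (Fin n) F) = P.poly.map (Polynomial.eval t) := rfl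

theorem gl_add (P : OneParam F n) (s t : F) : P.gl (s + t) = P.gl s * P.gl t :=
  Units.ext (P.map_add' s t)

theorem gl_zero (P : OneParam F n) : P.gl 0 = 1 := Units.ext P.map_zero'

theorem gl_natCast (P : OneParam F n) (k : ℕ) : P.gl (k : F) = P.gl 1 ^ k := by
  induction k with
  | zero => rw [Nat.cast_zero, gl_zero, pow_zero]
  | succ k ih => rw [Nat.cast_succ, gl_add, ih, pow_succ]

/-- The velocity at the identity of a one-parameter subgroup. -/
noncomputable def tangent (P : OneParam F n) : Matrix (Fin n) (Fin n) F :=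
  P.poly.map (Polynomial.coeff · 1)

theorem exists_degree_lt (P : OneParam F n) : ∃ N, ∀ i j, (P.poly i j).natDegree < N := by
  refine ⟨(∑ i, ∑ j, (P.poly i j).natDegree) + 1, fun i j => Nat.lt_succ_of_le ?_⟩
  exact (Finset.single_le_sum (f := fun j => (P.poly i j).natDegree) (fun _ _ => Nat.zero_le _)
    (Finset.mem_univ j)).trans
    (Finset.single_le_sum (f := fun i => ∑ j, (P.poly i j).natDegree) (fun _ _ => Nat.zero_le _)
    (Finset.mem_univ i))

variable [CharZero F]

theorem derivative_poly (P : OneParam F n) :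
    P.poly.map Polynomial.derivative = P.poly * P.tangent.map Polynomial.C := by
  ext1 i j
  refine Polynomial.funext fun s => ?_
  have h : Polynomial.taylor s (P.poly i j) =
      ∑ k, Polynomial.C ((P.poly i k).eval s) * P.poly k j := by
    refine Polynomial.funext fun t => ?_
    rw [Polynomial.taylor_eval, Polynomial.eval_finsetSum]
    have h2 := congrFun (congrFun (P.map_add' s t) i) j
    rw [Matrix.map_apply, Matrix.mul_apply] at h2
    rw [add_comm, h2]
    simp
  have h1 := congrArg (Polynomial.coeff · 1) h
  simp only [Polynomial.taylor_coeff_one, Polynomial.finsetSum_coeff,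
    Polynomial.coeff_C_mul] at h1
  rw [Matrix.map_apply, h1, Matrix.mul_apply, Polynomial.eval_finsetSum]
  simp [tangent]

theorem coeff_poly (P : OneParam F n) (k : ℕ) :
    P.poly.map (Polynomial.coeff · k) = (k.factorial : F)⁻¹ • P.tangent ^ k := by
  induction k with
  | zero =>
    rw [pow_zero, Nat.factorial_zero, Nat.cast_one, inv_one, one_smul, ← P.map_zero']
    ext i j
    simp [Polynomial.coeff_zero_eq_eval_zero]
  | succ k ih =>
    have h : ((k + 1 : ℕ) : F) • P.poly.map (Polynomial.coeff · (k + 1)) =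
        P.poly.map (Polynomial.coeff · k) * P.tangent := by
      ext i j
      have := congrArg (Polynomial.coeff · k) (congrFun (congrFun P.derivative_poly i) j)
      simp only [Matrix.map_apply, Polynomial.coeff_derivative, Matrix.mul_apply,
        Polynomial.finsetSum_coeff, Polynomial.coeff_mul_C] at this
      simp only [Matrix.smul_apply, Matrix.map_apply, Matrix.mul_apply, smul_eq_mul]
      rw [← this]
      push_cast
      ring
    rw [ih, smul_mul_assoc, ← pow_succ] at h
    have hk : ((k + 1 : ℕ) : F) ≠ 0 := by exact_mod_cast k.succ_ne_zero
    rw [← inv_smul_smul₀ hk (P.poly.map _), h, smul_smul, Nat.factorial_succ, Nat.cast_mul,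
      mul_inv]

theorem isNilpotent_tangent (P : OneParam F n) : IsNilpotent P.tangent := by
  obtain ⟨N, hN⟩ := P.exists_degree_lt
  refine ⟨N, ?_⟩
  have h := P.coeff_poly N
  have h0 : P.poly.map (Polynomial.coeff · N) = 0 := by
    ext i j
    exact Polynomial.coeff_eq_zero_of_natDegree_lt (hN i j)
  rw [h0] at h
  exact (smul_eq_zero.1 h.symm).resolve_left (inv_ne_zero (by exact_mod_cast N.factorial_ne_zero))

theorem coe_gl_eq_sum (P : OneParam F n) (t : F) : ∃ N, (P.gl t : Matrix (Fin n) (Fin n) F) =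
    ∑ k ∈ Finset.range N, (t ^ k * (k.factorial : F)⁻¹) • P.tangent ^ k := by
  obtain ⟨N, hN⟩ := P.exists_degree_lt
  refine ⟨N, ?_⟩
  ext i j
  rw [coe_gl, Matrix.map_apply, Polynomial.eval_eq_sum_range' (hN i j), Matrix.sum_apply]
  refine Finset.sum_congr rfl fun k _ => ?_
  have := congrFun (congrFun (P.coeff_poly k) i) j
  rw [Matrix.map_apply] at this
  rw [this, Matrix.smul_apply, Matrix.smul_apply, smul_eq_mul, smul_eq_mul]
  ring

theorem isUnipotentElt_gl (P : OneParam F n) (t : F) : IsUnipotentElt F n (P.gl t) := by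
  obtain ⟨N, hN⟩ := P.coe_gl_eq_sum t
  rw [IsUnipotentElt, hN]
  cases N with
  | zero =>
    have h : ((P.gl t : GL (Fin n) F) : Matrix (Fin n) (Fin n) F) = 0 := by simpa using hN
    have h1 : (1 : Matrix (Fin n) (Fin n) F) = 0 := by
      rw [← Units.mul_inv (P.gl t), h, zero_mul]
    exact ⟨1, by rw [h1]; simp⟩
  | succ N =>
    rw [Finset.sum_range_succ']
    simp only [pow_zero, Nat.factorial_zero, Nat.cast_one, inv_one, mul_one, one_smul,
      add_sub_cancel_right]
    refine Commute.isNilpotent_sum (fun k _ => ?_) fun k l _ _ => ?_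
    · exact (P.isNilpotent_tangent.pow_succ k).smul _
    · exact (((Commute.refl P.tangent).pow_pow _ _).smul_left _).smul_right _

theorem gl_eq_one_of_tangent_eq_zero (P : OneParam F n) (h : P.tangent = 0) (t : F) :
    P.gl t = 1 := by
  have hd := P.derivative_poly
  rw [h] at hd
  have h0 : ∀ i j, Polynomial.derivative (P.poly i j) = 0 := by
    intro i j
    have := congrFun (congrFun hd i) j
    simpa [Matrix.mul_apply] using this
  rw [← P.gl_zero]
  refine Units.ext (Matrix.ext fun i j => ?_)
  rw [coe_gl, coe_gl, Matrix.map_apply, Matrix.map_apply,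
    Polynomial.eq_C_of_derivative_eq_zero (h0 i j), Polynomial.eval_C, Polynomial.eval_C]

theorem det_gl (P : OneParam F n) (t : F) : (P.gl t : Matrix (Fin n) (Fin n) F).det = 1 := by
  have h : ∀ t, P.poly.det.eval t = (P.gl t : Matrix (Fin n) (Fin n) F).det := by
    intro t
    have := RingHom.map_det (Polynomial.evalRingHom t) P.poly
    rwa [Polynomial.coe_evalRingHom] at this
  have hu : P.poly.det * P.poly.det.comp (-Polynomial.X) = 1 := by
    refine Polynomial.funext fun s => ?_
    rw [Polynomial.eval_mul, Polynomial.eval_comp, Polynomial.eval_neg, Polynomial.eval_X, h, h,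
      ← Matrix.det_mul, ← Units.val_mul, ← gl_add, add_neg_cancel, gl_zero, Units.val_one,
      Matrix.det_one, Polynomial.eval_one]
  obtain ⟨c, -, hc⟩ := Polynomial.isUnit_iff.1 (IsUnit.of_mul_eq_one _ hu)
  have h0 := h 0
  rw [gl_zero, Units.val_one, Matrix.det_one, ← hc, Polynomial.eval_C] at h0
  rw [← h, ← hc, Polynomial.eval_C, h0]

/-- A matrix of polynomials interpolating the powers of an invertible matrix defines a
one-parameter subgroup. -/
noncomputable def ofPow (Q : Matrix (Fin n) (Fin n) (Polynomial F)) (u : GL (Fin n) F)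
    (h : ∀ k : ℕ, Q.map (Polynomial.eval (k : F)) = (u : Matrix (Fin n) (Fin n) F) ^ k) :
    OneParam F n where
  poly := Q
  map_add' := by
    have key : ∀ p : Polynomial F, (∀ k : ℕ, p.eval (k : F) = 0) → p = 0 := fun p hp =>
      Polynomial.eq_zero_of_infinite_isRoot p
        ((Set.infinite_range_of_injective (Nat.cast_injective (R := F))).mono
          (by rintro _ ⟨k, rfl⟩; exact hp k))
    have h1 : ∀ (k : ℕ) (t : F), Q.map (Polynomial.eval (k + t)) =
        Q.map (Polynomial.eval (k : F)) * Q.map (Polynomial.eval t) := by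
      intro k t
      ext i j
      have h2 := key (Polynomial.taylor (k : F) (Q i j) -
        ∑ l, Polynomial.C ((Q i l).eval (k : F)) * Q l j) fun m => by
          have h3 := congrFun (congrFun (h (m + k)) i) j
          rw [add_comm m k, pow_add, ← h, ← h, Nat.cast_add, add_comm (k : F)] at h3
          simp only [Matrix.map_apply, Matrix.mul_apply] at h3
          rw [Polynomial.eval_sub, Polynomial.taylor_eval, h3, Polynomial.eval_finsetSum]
          simp
      have h4 := congrArg (Polynomial.eval t) h2
      rw [Polynomial.eval_sub, Polynomial.taylor_eval, Polynomial.eval_finsetSum,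
        Polynomial.eval_zero, sub_eq_zero, add_comm] at h4
      simpa [Matrix.mul_apply] using h4
    intro s t
    ext i j
    have h2 := key (Polynomial.taylor t (Q i j) -
        ∑ l, Q i l * Polynomial.C ((Q l j).eval t)) fun m => by
          have h3 := congrFun (congrFun (h1 m t) i) j
          simp only [Matrix.map_apply, Matrix.mul_apply] at h3
          rw [Polynomial.eval_sub, Polynomial.taylor_eval, h3, Polynomial.eval_finsetSum]
          simp
    have h4 := congrArg (Polynomial.eval s) h2
    rw [Polynomial.eval_sub, Polynomial.taylor_eval, Polynomial.eval_finsetSum,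
        Polynomial.eval_zero, sub_eq_zero] at h4
    simpa [Matrix.mul_apply] using h4
  map_zero' := by simpa using h 0

end OneParam

variable {F : Type} [Field F] {n : ℕ}

theorem coeff_one_binomPoly_zero : (binomPoly F 0).coeff 1 = 0 := by
  simp [binomPoly, Polynomial.coeff_one]

theorem pow_eq_zero_of_isNilpotent {A : Matrix (Fin n) (Fin n) F} (hA : IsNilpotent A) :
    A ^ n = 0 := by
  have h := (Matrix.isNilpotent_charpoly_sub_pow_of_isNilpotent hA).eq_zero
  have h2 := Matrix.aeval_self_charpoly A
  rw [sub_eq_zero.1 h] at h2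
  simpa using h2

variable [CharZero F]

theorem coeff_one_binomPoly_succ (j : ℕ) :
    (binomPoly F (j + 1)).coeff 1 = (-1) ^ j / ((j + 1 : ℕ) : F) := by
  have h : ((descPochhammer F j).comp (Polynomial.X - 1)).coeff 0 = (-1) ^ j * j.factorial := by
    rw [Polynomial.coeff_zero_eq_eval_zero, Polynomial.eval_comp]
    simp only [Polynomial.eval_sub, Polynomial.eval_X, Polynomial.eval_one, zero_sub]
    induction j with
    | zero => simp
    | succ j ih =>
      rw [descPochhammer_succ_eval, ih, Nat.factorial_succ]
      push_cast
      ring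
  rw [binomPoly, Polynomial.coeff_C_mul, descPochhammer_succ_left, Polynomial.coeff_X_mul, h,
    Nat.factorial_succ]
  have h1 : (j.factorial : F) ≠ 0 := by exact_mod_cast j.factorial_ne_zero
  have h2 : ((j + 1 : ℕ) : F) ≠ 0 := by exact_mod_cast j.succ_ne_zero
  rw [Nat.cast_mul]
  field_simp

/-- A unipotent matrix lies in a one-parameter subgroup, with velocity its logarithm. -/
theorem exists_oneParam_of_isUnipotentElt {u : GL (Fin n) F} (hu : IsUnipotentElt F n u) :
    ∃ P : OneParam F n, P.gl 1 = u ∧ P.tangent = matLog F n u := by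
  have hn : ((u : Matrix (Fin n) (Fin n) F) - 1) ^ (n + 1) = 0 := by
    rw [pow_succ, pow_eq_zero_of_isNilpotent hu, zero_mul]
  let Q : Matrix (Fin n) (Fin n) (Polynomial F) := Matrix.of fun i j =>
    ∑ k ∈ Finset.range (n + 1),
      Polynomial.C ((((u : Matrix (Fin n) (Fin n) F) - 1) ^ k) i j) * binomPoly F k
  have hQ : ∀ k : ℕ, Q.map (Polynomial.eval (k : F)) = (u : Matrix (Fin n) (Fin n) F) ^ k := by
    intro k
    have h := one_add_pow_eq_sum hn k
    rw [add_sub_cancel] at h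
    rw [h]
    ext i j
    simp only [Q, Matrix.map_apply, Matrix.of_apply, Polynomial.eval_finsetSum,
      Polynomial.eval_mul, Polynomial.eval_C, binomPoly_eval_natCast, Matrix.sum_apply,
      Matrix.smul_apply]
    exact Finset.sum_congr rfl fun _ _ => by rw [nsmul_eq_mul, mul_comm]
  refine ⟨OneParam.ofPow Q u hQ, Units.ext ?_, ?_⟩
  · have h := hQ 1
    rwa [Nat.cast_one, pow_one] at h
  · ext i j
    change (Q i j).coeff 1 = _
    simp only [Q, Matrix.of_apply, Polynomial.finsetSum_coeff, Polynomial.coeff_C_mul, matLog,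
      Matrix.sum_apply, Matrix.smul_apply]
    rw [Finset.sum_range_succ', coeff_one_binomPoly_zero, mul_zero, add_zero,
      ← Finset.Ico_add_one_right_eq_Icc, Finset.sum_Ico_eq_sum_range]
    refine Finset.sum_congr (by simp) fun k _ => ?_
    rw [coeff_one_binomPoly_succ, add_comm 1 k, smul_eq_mul]
    ring

theorem OneParam.poly_ext {P Q : OneParam F n} (h : P.gl 1 = Q.gl 1) : P.poly = Q.poly := by
  ext1 i j
  rw [← sub_eq_zero]
  refine Polynomial.eq_zero_of_infinite_isRoot _
    ((Set.infinite_range_of_injective (Nat.cast_injective (R := F))).mono ?_)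
  rintro _ ⟨k, rfl⟩
  have h1 : P.gl (k : F) = Q.gl k := by rw [gl_natCast, gl_natCast, h]
  have h2 : (P.gl (k : F) : Matrix (Fin n) (Fin n) F) i j =
      (Q.gl (k : F) : Matrix (Fin n) (Fin n) F) i j := by rw [h1]
  simp only [coe_gl, Matrix.map_apply] at h2
  rw [Set.mem_ofPred_eq, Polynomial.IsRoot, Polynomial.eval_sub, h2, sub_self]

theorem OneParam.matLog_gl_one (P : OneParam F n) : matLog F n (P.gl 1) = P.tangent := by
  obtain ⟨Q, hQ, hQ'⟩ := exists_oneParam_of_isUnipotentElt (P.isUnipotentElt_gl 1)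
  rw [← hQ', tangent, tangent, poly_ext hQ]

theorem exists_oneParam_of_isNilpotent {A : Matrix (Fin n) (Fin n) F} (hA : IsNilpotent A) :
    ∃ P : OneParam F n, P.tangent = A := by
  let Q : Matrix (Fin n) (Fin n) (Polynomial F) := Matrix.of fun i j =>
    ∑ k ∈ Finset.range (n + 2),
      Polynomial.C ((k.factorial : F)⁻¹ * (A ^ k) i j) * Polynomial.X ^ k
  have hn : A ^ (n + 2) = 0 := by
    rw [pow_add, pow_eq_zero_of_isNilpotent hA, zero_mul]
  have hQ : ∀ t, Q.map (Polynomial.eval t) = IsNilpotent.exp (t • A) := by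
    intro t
    have ht : (t • A) ^ (n + 2) = 0 := by rw [smul_pow, hn, smul_zero]
    rw [IsNilpotent.exp_eq_sum ht]
    ext i j
    simp only [Q, Matrix.map_apply, Matrix.of_apply, Polynomial.eval_finsetSum,
      Polynomial.eval_mul, Polynomial.eval_C, Polynomial.eval_pow, Polynomial.eval_X,
      Matrix.sum_apply, Matrix.smul_apply, smul_pow]
    refine Finset.sum_congr rfl fun k _ => ?_
    rw [Rat.smul_def, smul_eq_mul]
    push_cast
    ring
  refine ⟨⟨Q, fun s t => ?_, ?_⟩, ?_⟩
  · rw [hQ, hQ, hQ, add_smul, IsNilpotent.exp_add_of_commute _ (hA.smul s) (hA.smul t)]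
    exact ((Commute.refl A).smul_left s).smul_right t
  · rw [hQ, zero_smul, IsNilpotent.exp_zero]
  · ext i j
    change (Q i j).coeff 1 = _
    simp only [Q, Matrix.of_apply, Polynomial.finsetSum_coeff, Polynomial.coeff_C_mul,
      Polynomial.coeff_X_pow]
    rw [Finset.sum_eq_single 1] <;> simp +contextual [eq_comm]

end OneParameter

section InvariantDerivation

variable {F : Type} [Field F] {n : ℕ}

/-- The derivation of the coordinate ring of matrices given by the left-invariant vector field
`g ↦ g * A`. -/
noncomputable def matDeriv (A : Matrix (Fin n) (Fin n) F) (p : MvPolynomial (Fin n × Fin n) F) :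
    MvPolynomial (Fin n × Fin n) F :=
  ∑ ij : Fin n × Fin n, MvPolynomial.pderiv ij p *
    ∑ k, MvPolynomial.X (ij.1, k) * MvPolynomial.C (A k ij.2)

/-- The restriction of a polynomial to the curve `t ↦ g * P t`. -/
noncomputable def curvePoly (g : Matrix (Fin n) (Fin n) F) (P : OneParam F n) :
    MvPolynomial (Fin n × Fin n) F →ₐ[F] Polynomial F :=
  MvPolynomial.aeval fun ij => (g.map Polynomial.C * P.poly) ij.1 ij.2

theorem eval_curvePoly (g : Matrix (Fin n) (Fin n) F) (P : OneParam F n)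
    (p : MvPolynomial (Fin n × Fin n) F) (t : F) :
    (curvePoly g P p).eval t = evalMat (g * (P.gl t : Matrix (Fin n) (Fin n) F)) p := by
  induction p using MvPolynomial.induction_on with
  | C c => simp [curvePoly, evalMat]
  | add p q hp hq => rw [map_add, Polynomial.eval_add, hp, hq, map_add]
  | mul_X p i hp =>
    rw [map_mul, Polynomial.eval_mul, hp, map_mul]
    congr 1
    simp [curvePoly, evalMat, Matrix.mul_apply, OneParam.coe_gl, Polynomial.eval_finsetSum]

theorem derivative_curvePoly [CharZero F] (g : Matrix (Fin n) (Fin n) F) (P : OneParam F n)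
    (p : MvPolynomial (Fin n × Fin n) F) :
    Polynomial.derivative (curvePoly g P p) = curvePoly g P (matDeriv P.tangent p) := by
  induction p using MvPolynomial.induction_on with
  | C c => simp [curvePoly, matDeriv]
  | add p q hp hq =>
    rw [map_add, map_add, hp, hq, ← map_add]
    congr 1
    simp only [matDeriv, map_add, add_mul, Finset.sum_add_distrib]
  | mul_X p i hp =>
    have h1 : matDeriv P.tangent (p * MvPolynomial.X i) =
        matDeriv P.tangent p * MvPolynomial.X i +
        p * ∑ k, MvPolynomial.X (i.1, k) * MvPolynomial.C (P.tangent k i.2) := by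
      simp only [matDeriv, Derivation.leibniz, MvPolynomial.pderiv_X, smul_eq_mul, add_mul,
        Finset.sum_add_distrib]
      rw [add_comm, Finset.sum_mul]
      congr 1
      · refine Finset.sum_congr rfl fun j _ => ?_
        ring
      · rw [Finset.sum_eq_single i]
        · simp
        · intro j _ hj
          simp [hj.symm]
        · simp
    have h2 : Polynomial.derivative (curvePoly g P (MvPolynomial.X i)) = curvePoly g P
        (∑ k, MvPolynomial.X (i.1, k) * MvPolynomial.C (P.tangent k i.2)) := by
      have h3 : (g.map Polynomial.C * P.poly).map Polynomial.derivative =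
          g.map Polynomial.C * P.poly * P.tangent.map Polynomial.C := by
        rw [Matrix.mul_assoc, ← P.derivative_poly]
        ext1 i j
        simp [Matrix.mul_apply]
      have h4 := (congrFun (congrFun h3 i.1) i.2).trans Matrix.mul_apply
      rw [Matrix.map_apply] at h4
      simpa [curvePoly] using h4
    rw [map_mul, Polynomial.derivative_mul, hp, h2, h1, map_add, map_mul, map_mul]

theorem matDeriv_mem_of_gl_mem [CharZero F] {G : Subgroup (GL (Fin n) F)} {P : OneParam F n}
    (hP : ∀ t, P.gl t ∈ G) {p : MvPolynomial (Fin n × Fin n) F}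
    (hp : ∀ h ∈ G, evalMat (h : Matrix (Fin n) (Fin n) F) p = 0) :
    ∀ h ∈ G, evalMat (h : Matrix (Fin n) (Fin n) F) (matDeriv P.tangent p) = 0 := by
  intro h hh
  have h0 : curvePoly (h : Matrix (Fin n) (Fin n) F) P p = 0 := by
    refine Polynomial.funext fun t => ?_
    rw [eval_curvePoly, ← Units.val_mul, hp _ (G.mul_mem hh (hP t)), Polynomial.eval_zero]
  have h1 := derivative_curvePoly (h : Matrix (Fin n) (Fin n) F) P p
  rw [h0, Polynomial.derivative_zero] at h1
  have h2 := eval_curvePoly (h : Matrix (Fin n) (Fin n) F) P (matDeriv P.tangent p) 0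
  rw [← h1, Polynomial.eval_zero, P.gl_zero, Units.val_one, mul_one] at h2
  exact h2.symm

theorem gl_mem_of_matDeriv_mem [CharZero F] {G : Subgroup (GL (Fin n) F)} {P : OneParam F n}
    (hP : ∀ p : MvPolynomial (Fin n × Fin n) F,
      (∀ h ∈ G, evalMat (h : Matrix (Fin n) (Fin n) F) p = 0) →
      ∀ h ∈ G, evalMat (h : Matrix (Fin n) (Fin n) F) (matDeriv P.tangent p) = 0) (t : F) :
    P.gl t ∈ zariskiClosure G := by
  intro p hp
  have hk : ∀ k : ℕ, ∃ q : MvPolynomial (Fin n × Fin n) F,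
      (∀ h ∈ G, evalMat (h : Matrix (Fin n) (Fin n) F) q = 0) ∧
      Polynomial.derivative^[k] (curvePoly 1 P p) = curvePoly 1 P q := by
    intro k
    induction k with
    | zero => exact ⟨p, hp, rfl⟩
    | succ k ih =>
      obtain ⟨q, hq, hq'⟩ := ih
      exact ⟨_, hP q hq, by rw [Function.iterate_succ_apply', hq', derivative_curvePoly]⟩
  have h0 : curvePoly 1 P p = 0 := by
    ext k
    obtain ⟨q, hq, hq'⟩ := hk k
    have h1 := congrArg (Polynomial.coeff · 0) hq'
    simp only [Polynomial.coeff_iterate_derivative] at h1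
    rw [Polynomial.coeff_zero_eq_eval_zero, eval_curvePoly, P.gl_zero, Units.val_one, mul_one,
      ← Units.val_one, hq 1 G.one_mem, zero_add, nsmul_eq_mul, mul_eq_zero] at h1
    rw [Polynomial.coeff_zero]
    refine h1.resolve_left ?_
    rw [Nat.descFactorial_self]
    exact_mod_cast k.factorial_ne_zero
  have h1 := eval_curvePoly 1 P p t
  rw [h0, Polynomial.eval_zero, one_mul] at h1
  exact h1.symm

theorem gl_mem_of_gl_one_mem [CharZero F] {G : Subgroup (GL (Fin n) F)} {P : OneParam F n}
    (hP : P.gl 1 ∈ G) (t : F) : P.gl t ∈ zariskiClosure G := by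
  intro p hp
  have h0 : curvePoly 1 P p = 0 := by
    refine Polynomial.eq_zero_of_infinite_isRoot _
      ((Set.infinite_range_of_injective (Nat.cast_injective (R := F))).mono ?_)
    rintro _ ⟨k, rfl⟩
    rw [Set.mem_ofPred_eq, Polynomial.IsRoot, eval_curvePoly, one_mul, P.gl_natCast]
    exact hp _ (G.pow_mem hP k)
  have h1 := eval_curvePoly 1 P p t
  rw [h0, Polynomial.eval_zero, one_mul] at h1
  exact h1.symm

theorem matDeriv_add (A B : Matrix (Fin n) (Fin n) F) (p : MvPolynomial (Fin n × Fin n) F) :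
    matDeriv (A + B) p = matDeriv A p + matDeriv B p := by
  simp only [matDeriv, Matrix.add_apply, map_add, mul_add, Finset.sum_add_distrib]

theorem matDeriv_smul (c : F) (A : Matrix (Fin n) (Fin n) F)
    (p : MvPolynomial (Fin n × Fin n) F) : matDeriv (c • A) p = c • matDeriv A p := by
  simp only [matDeriv, Matrix.smul_apply, smul_eq_mul, map_mul, Finset.smul_sum, Finset.mul_sum,
    MvPolynomial.smul_eq_C_mul]
  refine Finset.sum_congr rfl fun _ _ => Finset.sum_congr rfl fun _ _ => ?_
  ring

/-- The differential of a homomorphism with regular coefficients. -/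
theorem exists_differential [CharZero F] {G : Subgroup (GL (Fin n) F)} {m : ℕ}
    (π : G →* GL (Fin m) F) {φ : Fin m → Fin m → GL (Fin n) F → F}
    (hφ : ∀ i j, φ i j ∈ regularFun F n)
    (hπ : ∀ (g : G) i j, (π g : Matrix (Fin m) (Fin m) F) i j = φ i j g) :
    ∃ δ : Matrix (Fin n) (Fin n) F →ₗ[F] Matrix (Fin m) (Fin m) F,
      ∀ (P : OneParam F n) (hP : ∀ t, P.gl t ∈ G), ∃ Q : OneParam F m,
        Q.tangent = δ P.tangent ∧ ∀ t, Q.gl t = π ⟨P.gl t, hP t⟩ := by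
  choose k p hp using hφ
  refine ⟨{ toFun := fun A => Matrix.of fun i j => evalMat 1 (matDeriv A (p i j))
            map_add' := fun A B => by ext i j; simp [matDeriv_add]
            map_smul' := fun c A => by
              ext i j
              simp [matDeriv_smul, MvPolynomial.smul_eq_C_mul, evalMat] }, fun P hP => ?_⟩
  have h : ∀ t, (Matrix.of fun i j => curvePoly 1 P (p i j)).map (Polynomial.eval t) =
      (π ⟨P.gl t, hP t⟩ : Matrix (Fin m) (Fin m) F) := by
    intro t
    ext i j
    rw [Matrix.map_apply, Matrix.of_apply, eval_curvePoly, one_mul, ← hp, P.det_gl, one_pow,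
      mul_one, hπ]
  refine ⟨⟨Matrix.of fun i j => curvePoly 1 P (p i j), fun s t => ?_, ?_⟩, ?_, fun t => ?_⟩
  · rw [h, h, h, ← Units.val_mul, ← map_mul]
    congr 2
    exact Subtype.ext (P.gl_add s t)
  · rw [h, ← Units.val_one, ← map_one π]
    congr 2
    exact Subtype.ext P.gl_zero
  · ext i j
    change (curvePoly 1 P (p i j)).coeff 1 = evalMat 1 (matDeriv P.tangent (p i j))
    have h1 := congrArg (Polynomial.eval 0) (derivative_curvePoly 1 P (p i j))
    rw [eval_curvePoly, P.gl_zero, Units.val_one, mul_one,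
      ← Polynomial.coeff_zero_eq_eval_zero, Polynomial.coeff_derivative] at h1
    simpa using h1
  · exact Units.ext (h t)

end InvariantDerivation

section LogarithmSpan

variable {F : Type} [Field F] [CharZero F] {n : ℕ}

theorem isNilpotent_of_mem_span_matLog {U : Subgroup (GL (Fin n) F)} [Group.IsSolvable U]
    (hU : ∀ u ∈ U, IsUnipotentElt F n u) {A : Matrix (Fin n) (Fin n) F}
    (hA : A ∈ Submodule.span F (matLog F n '' (U : Set (GL (Fin n) F)))) : IsNilpotent A := by
  let S : Set (Matrix (Fin n) (Fin n) F) :=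
    Set.range fun u : U => ((u : GL (Fin n) F) : Matrix (Fin n) (Fin n) F) - 1
  let N := Submodule.span F S
  have hmul : N * N ≤ N := by
    rw [Submodule.span_mul_span, Submodule.span_le]
    rintro _ ⟨_, ⟨u, rfl⟩, _, ⟨v, rfl⟩, rfl⟩
    have e : (((u : GL (Fin n) F) : Matrix (Fin n) (Fin n) F) - 1) *
        (((v : GL (Fin n) F) : Matrix (Fin n) (Fin n) F) - 1) =
        (((u * v : U) : GL (Fin n) F) : Matrix (Fin n) (Fin n) F) - 1 -
        (((u : GL (Fin n) F) : Matrix (Fin n) (Fin n) F) - 1) -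
        (((v : GL (Fin n) F) : Matrix (Fin n) (Fin n) F) - 1) := by
      rw [Subgroup.coe_mul, Units.val_mul]
      noncomm_ring
    change _ * _ ∈ N
    rw [e]
    exact N.sub_mem (N.sub_mem (Submodule.subset_span ⟨_, rfl⟩) (Submodule.subset_span ⟨_, rfl⟩))
      (Submodule.subset_span ⟨_, rfl⟩)
  have hpow : ∀ x ∈ N, ∀ k, x ^ (k + 1) ∈ N := by
    intro x hx k
    induction k with
    | zero => simpa using hx
    | succ k ih => rw [pow_succ]; exact hmul (Submodule.mul_mem_mul ih hx)
  have hAN : A ∈ N := by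
    refine (Submodule.span_le.2 ?_ : _ ≤ N) hA
    rintro _ ⟨u, hu, rfl⟩
    refine N.sum_mem fun k hk => N.smul_mem _ ?_
    obtain ⟨l, rfl⟩ : ∃ l, k = l + 1 := ⟨k - 1, by simp at hk; omega⟩
    exact hpow _ (Submodule.subset_span ⟨⟨u, hu⟩, rfl⟩) l
  have hNn : N ^ n = ⊥ := by
    rw [Submodule.span_pow, Submodule.span_eq_bot]
    intro x hx
    obtain ⟨f, rfl⟩ := Set.mem_pow.1 hx
    choose u hu using fun i => (f i).2
    have h := matrix_list_prod_sub_one_eq_zero U (S := Set.univ) (by simp)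
      (fun s _ => hU _ s.2) (List.ofFn u) (by simp)
    rw [List.map_ofFn] at h
    rw [← h]
    congr 2
    ext1 i
    exact (hu i).symm
  refine ⟨n, ?_⟩
  have := Submodule.pow_mem_pow N hAN n
  rwa [hNn, Submodule.mem_bot] at this

/-- Every element of the span of the logarithms of an algebraic unipotent group is tangent to a
one-parameter subgroup. -/
theorem exists_oneParam_of_mem_span {G U : Subgroup (GL (Fin n) F)}
    (hG : zariskiClosure G ≤ G) (hUG : U ≤ G) [Group.IsSolvable U]
    (hU : ∀ u ∈ U, IsUnipotentElt F n u) {A : Matrix (Fin n) (Fin n) F}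
    (hA : A ∈ Submodule.span F (matLog F n '' (U : Set (GL (Fin n) F)))) :
    ∃ P : OneParam F n, P.tangent = A ∧ ∀ t, P.gl t ∈ G := by
  obtain ⟨P, rfl⟩ := exists_oneParam_of_isNilpotent (isNilpotent_of_mem_span_matLog hU hA)
  refine ⟨P, rfl, fun t => hG (gl_mem_of_matDeriv_mem (fun p hp => ?_) t)⟩
  generalize P.tangent = B at hA
  induction hA using Submodule.span_induction with
  | mem x hx =>
    obtain ⟨u, hu, rfl⟩ := hx
    obtain ⟨Q, hQ, hQ'⟩ := exists_oneParam_of_isUnipotentElt (hU u hu)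
    rw [← hQ']
    exact matDeriv_mem_of_gl_mem
      (fun t => hG (gl_mem_of_gl_one_mem (by rw [hQ]; exact hUG hu) t)) hp
  | zero => intro h _; simp [matDeriv]
  | add x y _ _ hx hy =>
    intro h hh
    rw [matDeriv_add, map_add, hx h hh, hy h hh, add_zero]
  | smul c x _ hx =>
    intro h hh
    rw [matDeriv_smul, MvPolynomial.smul_eq_C_mul, map_mul, hx h hh, mul_zero]

end LogarithmSpan

section RegularRepresentation

variable {F : Type} [Field F] {n : ℕ}

/-- Functions on a linear group which are restrictions of regular functions. -/
noncomputable def regularOn (G : Subgroup (GL (Fin n) F)) : Subalgebra F (G → F) :=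
  (regularFun F n).map
    { toFun := fun φ g => φ g
      map_one' := rfl
      map_mul' := fun _ _ => rfl
      map_zero' := rfl
      map_add' := fun _ _ => rfl
      commutes' := fun _ => rfl }

theorem mem_regularOn {G : Subgroup (GL (Fin n) F)} {φ : G → F} :
    φ ∈ regularOn G ↔ ∃ ψ ∈ regularFun F n, ∀ g : G, ψ g = φ g := by
  constructor
  · rintro ⟨ψ, hψ, rfl⟩
    exact ⟨ψ, hψ, fun _ => rfl⟩
  · rintro ⟨ψ, hψ, h⟩
    exact ⟨ψ, hψ, funext h⟩

theorem comp_inv_mem_regularOn {G : Subgroup (GL (Fin n) F)} {φ : G → F} (h : φ ∈ regularOn G) :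
    (fun g => φ g⁻¹) ∈ regularOn G := by
  obtain ⟨ψ, hψ, h⟩ := mem_regularOn.1 h
  exact mem_regularOn.2 ⟨_, comp_inv_mem_regularFun hψ, fun g => h g⁻¹⟩

variable {G : Subgroup (GL (Fin n) F)} {E : Type} [AddCommGroup E] [Module F E]

/-- A representation of a linear group is regular if its matrix coefficients are. -/
def IsRegularRep (σ : Representation F G E) : Prop :=
  ∀ (l : Module.Dual F E) (v : E), (fun g => l (σ g v)) ∈ regularOn G

theorem isRegularRep_of_injective [FiniteDimensional F E] {σ : Representation F G E} {ι : Type}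
    [Finite ι] (Φ : E →ₗ[F] ι → F) (hΦ : Function.Injective Φ)
    (h : ∀ v i, (fun g => Φ (σ g v) i) ∈ regularOn G) : IsRegularRep σ := by
  have := Fintype.ofFinite ι
  classical
  intro l v
  obtain ⟨Ψ, hΨ⟩ := Φ.exists_leftInverse_of_injective (LinearMap.ker_eq_bot.2 hΦ)
  have e : (fun g => l (σ g v)) = ∑ i, l (Ψ (Pi.single i 1)) • fun g => Φ (σ g v) i := by
    ext g
    have h1 : l (σ g v) = (l ∘ₗ Ψ) (Φ (σ g v)) :=
      congrArg l (LinearMap.congr_fun hΨ (σ g v)).symm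
    rw [h1, LinearMap.pi_apply_eq_sum_univ, Finset.sum_apply]
    refine Finset.sum_congr rfl fun i _ => ?_
    have h2 : (fun j => if i = j then (1 : F) else 0) = Pi.single i 1 := by
      ext j; simp [Pi.single_apply, eq_comm]
    rw [h2]
    simp [mul_comm]
  rw [e]
  exact sum_mem fun i _ => (regularOn G).smul_mem (h v i) _

theorem IsRegularRep.subrepresentation {σ : Representation F G E} (h : IsRegularRep σ)
    (M : Submodule F E) (hM : ∀ g, M ≤ M.comap (σ g)) :
    IsRegularRep (σ.subrepresentation M hM) := by
  intro l v
  obtain ⟨l', hl'⟩ := LinearMap.exists_extend l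
  convert h l' v using 2 with g
  rw [← hl']
  rfl

theorem IsRegularRep.linHom [FiniteDimensional F E] {σ : Representation F G E}
    (h : IsRegularRep σ) : IsRegularRep (σ.linHom σ) := by
  let b := Module.finBasis F E
  refine isRegularRep_of_injective (ι := Fin _ × Fin _)
    (LinearMap.pi fun ij => b.coord ij.1 ∘ₗ LinearMap.applyₗ (b ij.2)) ?_ ?_
  · intro S T hST
    refine b.ext fun j => b.ext_elem fun i => ?_
    exact congrFun hST (i, j)
  · rintro T ⟨i, j⟩
    have e : (fun g => b.coord i (σ g (T (σ g⁻¹ (b j))))) =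
        ∑ k, (fun g => (b.coord k ∘ₗ T) (σ g⁻¹ (b j))) * fun g => b.coord i (σ g (b k)) := by
      ext g
      have h1 : ∀ x, b.coord i (σ g x) = ∑ k, b.coord k x * b.coord i (σ g (b k)) := by
        intro x
        conv_lhs => rw [← b.sum_repr x]
        simp only [map_sum, map_smul, smul_eq_mul, Module.Basis.coord_apply]
      rw [h1, Finset.sum_apply]
      rfl
    change (fun g => b.coord i (σ g (T (σ g⁻¹ (b j))))) ∈ _
    rw [e]
    exact sum_mem fun k _ => (regularOn G).mul_mem
      (comp_inv_mem_regularOn (h (b.coord k ∘ₗ T) (b j))) (h _ _)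

/-- The contragredient action on multilinear forms. -/
noncomputable def multilinearRep (σ : Representation F G E) (e : ℕ) :
    Representation F G (MultilinearMap F (fun _ : Fin e => E) F) where
  toFun g :=
    { toFun := fun ω => ω.compLinearMap fun _ => σ g⁻¹
      map_add' := fun _ _ => rfl
      map_smul' := fun _ _ => rfl }
  map_one' := by ext ω v; simp
  map_mul' g h := by ext ω v; simp; rfl

theorem multilinearRep_apply (σ : Representation F G E) {e : ℕ} (g : G)
    (ω : MultilinearMap F (fun _ : Fin e => E) F) (v : Fin e → E) :
    multilinearRep σ e g ω v = ω fun i => σ g⁻¹ (v i) := rfl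

theorem IsRegularRep.multilinearRep [FiniteDimensional F E] {σ : Representation F G E}
    (h : IsRegularRep σ) (e : ℕ) : IsRegularRep (multilinearRep σ e) := by
  let b := Module.finBasis F E
  refine isRegularRep_of_injective (ι := Fin e → Fin (Module.finrank F E))
    { toFun := fun ω s => ω fun i => b (s i)
      map_add' := fun _ _ => rfl
      map_smul' := fun _ _ => rfl } ?_ ?_
  · intro ω ω' hω
    exact Module.Basis.ext_multilinear (fun _ => b) fun s => congrFun hω s
  · intro ω s
    have e : (fun g => ω fun i => σ g⁻¹ (b (s i))) = ∑ r : Fin e → Fin (Module.finrank F E),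
        (ω fun i => b (r i)) • ∏ i, fun g => b.coord (r i) (σ g⁻¹ (b (s i))) := by
      ext g
      have h1 : (fun i => σ g⁻¹ (b (s i))) =
          fun i => ∑ k, b.coord k (σ g⁻¹ (b (s i))) • b k := by
        ext1 i
        exact (b.sum_repr _).symm
      rw [h1, MultilinearMap.map_sum]
      simp only [MultilinearMap.map_smul_univ]
      simp [mul_comm]
    change (fun g => ω fun i => σ g⁻¹ (b (s i))) ∈ _
    rw [e]
    exact sum_mem fun r _ => (regularOn G).smul_mem ((regularOn G).prod_mem fun i _ =>
      comp_inv_mem_regularOn (h (b.coord (r i)) (b (s i)))) _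

/-- From a line stable under a normal subgroup `N`, construct a representation on which `N` acts
trivially, and whose kernel stabilizes the line. -/
theorem exists_rep_trivial_on_normal [FiniteDimensional F E] {σ : Representation F G E}
    (hσ : IsRegularRep σ) (N : Subgroup G) [N.Normal] {ω : E} (hω : ω ≠ 0)
    (hN : ∀ h ∈ N, ∃ c : F, σ h ω = c • ω) :
    ∃ (B : Type) (_ : AddCommGroup B) (_ : Module F B) (_ : FiniteDimensional F B)
      (τ : Representation F G B), IsRegularRep τ ∧ (∀ h ∈ N, τ h = 1) ∧
      ∀ g, τ g = 1 → ∃ c : F, σ g ω = c • ω := by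
  let S : Set E := {v | ∃ χ : N → F, ∀ h : N, σ h v = χ h • v}
  let E' := Submodule.span F S
  have hωS : ω ∈ S := by
    choose χ hχ using fun h : N => hN h h.2
    exact ⟨χ, hχ⟩
  have hE' : ∀ g, E' ≤ E'.comap (σ g) := by
    intro g
    rw [Submodule.span_le]
    rintro v ⟨χ, hχ⟩
    refine Submodule.subset_span ⟨fun h => χ ⟨g⁻¹ * h * g, ?_⟩, fun h => ?_⟩
    · simpa using ‹N.Normal›.conj_mem h h.2 g⁻¹
    · rw [← map_smul, ← hχ]
      simp only [← Module.End.mul_apply, ← map_mul]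
      congr 2
      group
  let σ' := σ.subrepresentation E' hE'
  have hσ' : IsRegularRep σ' := hσ.subrepresentation E' hE'
  let B : Submodule F (Module.End F E') :=
    { carrier := {T | ∀ h ∈ N, σ' h * T = T * σ' h}
      add_mem' := fun {T T'} hT hT' h hh => by rw [mul_add, add_mul, hT h hh, hT' h hh]
      zero_mem' := fun h hh => by rw [mul_zero, zero_mul]
      smul_mem' := fun c T hT h hh => by rw [mul_smul_comm, smul_mul_assoc, hT h hh] }
  have hB : ∀ g, B ≤ B.comap ((σ'.linHom σ') g) := by
    intro g T hT h hh
    have h1 := hT (g⁻¹ * h * g) (by simpa using ‹N.Normal›.conj_mem h hh g⁻¹)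
    change σ' h * (σ' g * (T * σ' g⁻¹)) = σ' g * (T * σ' g⁻¹) * σ' h
    have e1 : σ' h = σ' g * σ' (g⁻¹ * h * g) * σ' g⁻¹ := by
      rw [← map_mul, ← map_mul]
      congr 1
      group
    have e2 : σ' g⁻¹ * σ' g = 1 := by rw [← map_mul, inv_mul_cancel, map_one]
    rw [e1]
    calc _ = σ' g * σ' (g⁻¹ * h * g) * (σ' g⁻¹ * σ' g) * (T * σ' g⁻¹) := by simp only [mul_assoc]
      _ = σ' g * (T * σ' (g⁻¹ * h * g)) * σ' g⁻¹ := by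
        rw [e2, mul_one, ← h1]; simp only [mul_assoc]
      _ = σ' g * T * (σ' g⁻¹ * σ' g) * σ' (g⁻¹ * h * g) * σ' g⁻¹ := by
        rw [e2, mul_one]; simp only [mul_assoc]
      _ = _ := by simp only [mul_assoc]
  have happ : ∀ g (T : B), (((σ'.linHom σ').subrepresentation B hB g T : B) : Module.End F E') =
      σ' g * (T * σ' g⁻¹) := fun g T => rfl
  refine ⟨B, inferInstance, inferInstance, inferInstance,
    (σ'.linHom σ').subrepresentation B hB, hσ'.linHom.subrepresentation B hB, ?_, ?_⟩
  · intro h hh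
    ext1 T
    refine Subtype.ext ?_
    rw [happ, ← mul_assoc, T.2 h hh, mul_assoc, ← map_mul, mul_inv_cancel, map_one, mul_one]
    rfl
  · intro g hg
    obtain ⟨b, hbS, hωb, hspan, hli⟩ := exists_linearIndepOn_id_extension
      ((LinearIndepOn.singleton (R := F) (v := id) (i := ω)) hω) (Set.singleton_subset_iff.2 hωS)
    let v : b → E' := fun x => ⟨x, Submodule.subset_span (hbS x.2)⟩
    have hv : LinearIndependent F v := by
      refine LinearIndependent.of_comp E'.subtype ?_
      exact hli
    have hvs : ⊤ ≤ Submodule.span F (Set.range v) := by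
      rintro ⟨x, hx⟩ -
      have h1 : x ∈ Submodule.span F b := Submodule.span_le.2 hspan hx
      have h2 : (Submodule.span F (Set.range v)).map E'.subtype = Submodule.span F b := by
        rw [Submodule.map_span, ← Set.range_comp]
        congr 1
        ext y
        simp [v]
      rw [← h2] at h1
      obtain ⟨y, hy, hyx⟩ := h1
      rwa [show (⟨x, hx⟩ : E') = y from Subtype.ext hyx.symm]
    let bas := Module.Basis.mk hv hvs
    let i0 : b := ⟨ω, hωb rfl⟩
    have hbas : ∀ j, bas j = v j := fun j => Module.Basis.mk_apply hv hvs j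
    let T : Module.End F E' := (bas.coord i0).smulRight (bas i0)
    have hT : T ∈ B := by
      intro h hh
      refine bas.ext fun j => ?_
      have heig : ∀ j, ∃ c : F, σ' h (bas j) = c • bas j := by
        intro j
        obtain ⟨χ, hχ⟩ := hbS j.2
        refine ⟨χ ⟨h, hh⟩, Subtype.ext ?_⟩
        rw [hbas]
        exact hχ ⟨h, hh⟩
      obtain ⟨c, hc⟩ := heig j
      obtain ⟨c0, hc0⟩ := heig i0
      rw [Module.End.mul_apply, Module.End.mul_apply, hc, map_smul]
      simp only [T, LinearMap.smulRight_apply, map_smul, hc0]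
      by_cases hj : j = i0
      · subst hj
        rw [hc0] at hc
        rw [smul_comm c, ← hc, smul_comm]
      · have : bas.coord i0 (bas j) = 0 := by
          simp [hj]
        rw [this]
        simp
    have h1 : σ' g * (T * σ' g⁻¹) = T := by
      have := congrArg Subtype.val (LinearMap.congr_fun hg (⟨T, hT⟩ : B))
      rwa [happ] at this
    have h2 : σ' g (bas i0) = T (σ' g (bas i0)) := by
      conv_rhs => rw [← h1]
      simp only [Module.End.mul_apply]
      rw [← Module.End.mul_apply (σ' g⁻¹), ← map_mul, inv_mul_cancel, map_one]
      simp [T]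
    refine ⟨bas.coord i0 (σ' g (bas i0)), ?_⟩
    have h3 := congrArg Subtype.val h2
    simp only [T, LinearMap.smulRight_apply] at h3
    have h4 : ((bas i0 : E') : E) = ω := by rw [hbas]
    rw [Submodule.coe_smul, h4] at h3
    rw [← h3]
    change σ g ω = σ g ((bas i0 : E') : E)
    rw [h4]

/-- A regular representation is given by matrices with regular coefficients. -/
theorem IsRegularRep.exists_matrix [FiniteDimensional F E] {τ : Representation F G E}
    (hτ : IsRegularRep τ) : ∃ (m : ℕ) (π : G →* GL (Fin m) F)
      (φ : Fin m → Fin m → GL (Fin n) F → F), (∀ i j, φ i j ∈ regularFun F n) ∧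
      (∀ (g : G) i j, (π g : Matrix (Fin m) (Fin m) F) i j = φ i j g) ∧
      ∀ g, π g = 1 ↔ τ g = 1 := by
  let b := Module.finBasis F E
  let π : G →* GL (Fin (Module.finrank F E)) F :=
    MonoidHom.toHomUnits (((LinearMap.toMatrixAlgEquiv b : _ →* _)).comp τ)
  have hπ : ∀ g, (π g : Matrix (Fin (Module.finrank F E)) (Fin (Module.finrank F E)) F) =
    LinearMap.toMatrixAlgEquiv b (τ g) := fun g => rfl
  choose φ hφ hφ' using fun i j => mem_regularOn.1 (hτ (b.coord i) (b j))
  refine ⟨_, π, φ, hφ, fun g i j => ?_, fun g => ?_⟩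
  · rw [hφ', hπ, LinearMap.toMatrixAlgEquiv_apply]
    rfl
  · rw [← Units.val_inj, hπ, Units.val_one, ← map_one (LinearMap.toMatrixAlgEquiv b)]
    exact (LinearMap.toMatrixAlgEquiv b).injective.eq_iff

end RegularRepresentation

section Translation

variable {F : Type} [Field F] {n : ℕ}

/-- Right translation of polynomial functions on matrices: `p ↦ (x ↦ p (x * a))`. -/
noncomputable def rightTranslate (a : Matrix (Fin n) (Fin n) F) :
    MvPolynomial (Fin n × Fin n) F →ₐ[F] MvPolynomial (Fin n × Fin n) F :=
  MvPolynomial.aeval fun ij => ∑ k, MvPolynomial.X (ij.1, k) * MvPolynomial.C (a k ij.2)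

theorem rightTranslate_X (a : Matrix (Fin n) (Fin n) F) (ij : Fin n × Fin n) :
    rightTranslate a (MvPolynomial.X ij) =
      ∑ k, MvPolynomial.X (ij.1, k) * MvPolynomial.C (a k ij.2) :=
  MvPolynomial.aeval_X _ _

theorem evalMat_rightTranslate (a x : Matrix (Fin n) (Fin n) F)
    (p : MvPolynomial (Fin n × Fin n) F) : evalMat x (rightTranslate a p) = evalMat (x * a) p := by
  induction p using MvPolynomial.induction_on with
  | C c => simp [rightTranslate, evalMat]
  | add p q hp hq => rw [map_add, map_add, hp, hq, map_add]
  | mul_X p i hp =>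
    rw [map_mul, map_mul, hp, map_mul, rightTranslate_X]
    congr 1
    simp [evalMat, Matrix.mul_apply]

theorem rightTranslate_one (p : MvPolynomial (Fin n × Fin n) F) : rightTranslate 1 p = p := by
  have : rightTranslate (1 : Matrix (Fin n) (Fin n) F) = AlgHom.id F _ := by
    refine MvPolynomial.algHom_ext fun ij => ?_
    rw [rightTranslate_X, Finset.sum_eq_single ij.2] <;> simp +contextual
  rw [this]
  rfl

theorem rightTranslate_mul (a b : Matrix (Fin n) (Fin n) F) (p : MvPolynomial (Fin n × Fin n) F) :
    rightTranslate (a * b) p = rightTranslate a (rightTranslate b p) := by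
  have : rightTranslate (a * b) = (rightTranslate a).comp (rightTranslate b) := by
    refine MvPolynomial.algHom_ext fun ij => ?_
    rw [AlgHom.comp_apply, rightTranslate_X, rightTranslate_X, map_sum]
    simp only [map_mul, rightTranslate_X, Matrix.mul_apply, map_sum, Finset.mul_sum, Finset.sum_mul]
    rw [Finset.sum_comm]
    refine Finset.sum_congr rfl fun k _ => Finset.sum_congr rfl fun l _ => ?_
    rw [show rightTranslate a (MvPolynomial.C (b k ij.2)) = MvPolynomial.C (b k ij.2) from
      MvPolynomial.aeval_C _ _]
    ring
  rw [this]
  rfl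

theorem totalDegree_rightTranslate_le (a : Matrix (Fin n) (Fin n) F)
    (p : MvPolynomial (Fin n × Fin n) F) : (rightTranslate a p).totalDegree ≤ p.totalDegree := by
  rw [rightTranslate, MvPolynomial.aeval_def, MvPolynomial.eval₂_eq]
  refine MvPolynomial.totalDegree_finsetSum_le fun s hs => ?_
  refine (MvPolynomial.totalDegree_mul _ _).trans ?_
  rw [MvPolynomial.algebraMap_eq, MvPolynomial.totalDegree_C, zero_add]
  refine (MvPolynomial.totalDegree_finsetProd _ _).trans
    (le_trans (Finset.sum_le_sum fun i _ => ?_) (MvPolynomial.le_totalDegree hs))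
  refine (MvPolynomial.totalDegree_pow _ _).trans ?_
  refine (Nat.mul_le_mul_left (s i) ?_).trans (mul_one _).le
  refine MvPolynomial.totalDegree_finsetSum_le fun k _ => ?_
  refine (MvPolynomial.totalDegree_mul _ _).trans ?_
  rw [MvPolynomial.totalDegree_C, add_zero, MvPolynomial.totalDegree_X]

theorem apply_rightTranslate_mem_regularFun (p : MvPolynomial (Fin n × Fin n) F) :
    ∀ l : MvPolynomial (Fin n × Fin n) F →ₗ[F] F,
      (fun g : GL (Fin n) F => l (rightTranslate (g : Matrix (Fin n) (Fin n) F) p)) ∈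
        regularFun F n := by
  induction p using MvPolynomial.induction_on with
  | C c =>
    intro l
    have : ∀ g : GL (Fin n) F, rightTranslate (g : Matrix (Fin n) (Fin n) F) (MvPolynomial.C c) =
      MvPolynomial.C c := fun g => MvPolynomial.aeval_C _ _
    simp only [this]
    exact const_mem_regularFun _
  | add p q hp hq =>
    intro l
    simp only [map_add]
    exact (regularFun F n).add_mem (hp l) (hq l)
  | mul_X p i hp =>
    intro l
    have : (fun g : GL (Fin n) F =>
        l (rightTranslate (g : Matrix (Fin n) (Fin n) F) (p * MvPolynomial.X i))) =
        ∑ k, (fun g : GL (Fin n) F => (g : Matrix (Fin n) (Fin n) F) k i.2) *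
          fun g : GL (Fin n) F => (l ∘ₗ LinearMap.mulRight F (MvPolynomial.X (i.1, k)))
            (rightTranslate (g : Matrix (Fin n) (Fin n) F) p) := by
      ext g
      rw [map_mul, rightTranslate_X, Finset.mul_sum, map_sum, Finset.sum_apply]
      refine Finset.sum_congr rfl fun k _ => ?_
      rw [Pi.mul_apply, LinearMap.comp_apply, LinearMap.mulRight_apply]
      refine Eq.trans ?_ (l.map_smul ((g : Matrix (Fin n) (Fin n) F) k i.2) _)
      rw [MvPolynomial.smul_eq_C_mul]
      congr 1
      ring
    rw [this]
    exact sum_mem fun k _ => (regularFun F n).mul_mem (entry_mem_regularFun _ _) (hp _)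

/-- The action of a linear group on polynomial functions by right translation. -/
noncomputable def rightTranslateRep (G : Subgroup (GL (Fin n) F)) :
    Representation F G (MvPolynomial (Fin n × Fin n) F) where
  toFun g := (rightTranslate ((g : GL (Fin n) F) : Matrix (Fin n) (Fin n) F)).toLinearMap
  map_one' := LinearMap.ext fun p => rightTranslate_one p
  map_mul' _ _ := LinearMap.ext fun p => rightTranslate_mul _ _ p

/-- A closed subgroup is the stabilizer of a subspace in a regular representation. -/
theorem exists_rep_submodule (G N : Subgroup (GL (Fin n) F)) (hN : zariskiClosure N ≤ N) :
    ∃ (W : Type) (_ : AddCommGroup W) (_ : Module F W) (_ : FiniteDimensional F W)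
      (σ : Representation F G W) (M : Submodule F W), IsRegularRep σ ∧
      ∀ g : G, (g : GL (Fin n) F) ∈ N ↔ M ≤ M.comap (σ g) := by
  let I : Ideal (MvPolynomial (Fin n × Fin n) F) :=
    { carrier := {p | ∀ h ∈ N, evalMat (h : Matrix (Fin n) (Fin n) F) p = 0}
      add_mem' := fun {p q} hp hq h hh => by rw [map_add, hp h hh, hq h hh, add_zero]
      zero_mem' := fun h _ => map_zero _
      smul_mem' := fun c p hp h hh => by rw [smul_eq_mul, map_mul, hp h hh, mul_zero] }
  obtain ⟨s, hs⟩ := (isNoetherianRing_iff_ideal_fg _).1 inferInstance I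
  let d := s.sup MvPolynomial.totalDegree
  let W := MvPolynomial.restrictTotalDegree (Fin n × Fin n) F d
  have hW : ∀ g, W ≤ W.comap (rightTranslateRep G g) := fun g p hp => by
    rw [MvPolynomial.mem_restrictTotalDegree] at hp
    rw [Submodule.mem_comap, MvPolynomial.mem_restrictTotalDegree]
    exact (totalDegree_rightTranslate_le _ _).trans hp
  let M : Submodule F W := (I.restrictScalars F).comap W.subtype
  refine ⟨W, inferInstance, inferInstance, inferInstance,
    (rightTranslateRep G).subrepresentation W hW, M, ?_, fun g => ⟨fun hg p hp h hh => ?_, fun h => ?_⟩⟩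
  · intro l p
    obtain ⟨l', hl'⟩ := LinearMap.exists_extend l
    refine mem_regularOn.2 ⟨_, apply_rightTranslate_mem_regularFun p l', fun g => ?_⟩
    rw [← hl']
    rfl
  · change evalMat _ (rightTranslate _ _) = 0
    rw [evalMat_rightTranslate, ← Units.val_mul]
    exact hp _ (N.mul_mem hh hg)
  · refine hN fun p hp => ?_
    have hpI : p ∈ Ideal.span (s : Set (MvPolynomial (Fin n × Fin n) F)) := by
      rw [hs]; exact hp
    suffices h : Ideal.span (s : Set (MvPolynomial (Fin n × Fin n) F)) ≤
        RingHom.ker (evalMat ((g : GL (Fin n) F) : Matrix (Fin n) (Fin n) F)) from h hpI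
    rw [Ideal.span_le]
    intro q hq
    have hqI : q ∈ I := hs ▸ Ideal.subset_span hq
    have hqW : q ∈ W := (MvPolynomial.mem_restrictTotalDegree _ _ _).2
      (Finset.le_sup (f := MvPolynomial.totalDegree) hq)
    have h1 : evalMat ((1 : GL (Fin n) F) : Matrix (Fin n) (Fin n) F)
        (rightTranslate ((g : GL (Fin n) F) : Matrix (Fin n) (Fin n) F) q) = 0 :=
      h (show (⟨q, hqW⟩ : W) ∈ M from hqI) 1 N.one_mem
    rw [evalMat_rightTranslate, Units.val_one, one_mul] at h1
    exact h1

/-- Chevalley: the stabilizer of a subspace is the stabilizer of a line. -/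
theorem exists_rep_line {G : Subgroup (GL (Fin n) F)} {W : Type} [AddCommGroup W] [Module F W]
    [FiniteDimensional F W] {σ : Representation F G W} (hσ : IsRegularRep σ)
    (M : Submodule F W) :
    ∃ (E : Type) (_ : AddCommGroup E) (_ : Module F E) (_ : FiniteDimensional F E)
      (τ : Representation F G E) (ω : E), IsRegularRep τ ∧ ω ≠ 0 ∧
      ∀ g, M ≤ M.comap (σ g⁻¹) ↔ ∃ c : F, τ g ω = c • ω := by
  let e := Module.finrank F (W ⧸ M)
  let b : Module.Basis (Fin e) F (W ⧸ M) := Module.finBasis F (W ⧸ M)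
  let ω : MultilinearMap F (fun _ : Fin e => W) F :=
    (b.det.compLinearMap M.mkQ).toMultilinearMap
  have hω : ∀ v, ω v = b.det fun i => M.mkQ (v i) := fun v => rfl
  obtain ⟨v, hv⟩ : ∃ v : Fin e → W, (fun i => M.mkQ (v i)) = b := by
    choose v hv using fun i => M.mkQ_surjective (b i)
    exact ⟨v, funext hv⟩
  have hrad : ∀ w, w ∈ M ↔ ∀ (v : Fin e → W) i, ω (Function.update v i w) = 0 := by
    intro w
    constructor
    · intro hw v i
      refine (hω _).trans (b.det.map_coord_zero i ?_)
      simpa using hw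
    · intro h
      have h1 : ∀ i, b.repr (M.mkQ w) i = 0 := by
        intro i
        have h2 := h v i
        have h3 : (fun j => M.mkQ (Function.update v i w j)) =
            Function.update b i (M.mkQ w) := by
          rw [← hv]
          ext1 j
          rcases eq_or_ne j i with rfl | hj
          · simp
          · simp [hj]
        have h4 : b.det.toMultilinearMap.toLinearMap b i = b.coord i := by
          refine b.ext fun k => ?_
          rw [MultilinearMap.toLinearMap_apply, Module.Basis.coord_apply, Module.Basis.repr_self]
          rcases eq_or_ne k i with rfl | hik
          · rw [Function.update_eq_self, Finsupp.single_eq_same]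
            exact b.det_self
          · rw [Finsupp.single_eq_of_ne hik.symm]
            exact b.det.map_eq_zero_of_eq _ (by simp [hik]) hik
        rw [hω, h3] at h2
        rw [← Module.Basis.coord_apply, ← h4]
        exact h2
      have h2 : M.mkQ w = 0 := b.ext_elem fun i => by rw [h1]; simp
      simpa using h2
  refine ⟨MultilinearMap F (fun _ : Fin e => W) F, inferInstance, inferInstance, inferInstance,
    multilinearRep σ e, ω, hσ.multilinearRep e, ?_, fun g => ⟨fun h => ?_, ?_⟩⟩
  · intro h0
    have h1 : ω v = 1 := by rw [hω, hv, Module.Basis.det_self]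
    rw [h0] at h1
    simp at h1
  · let T : (W ⧸ M) →ₗ[F] W ⧸ M := M.mapQ M (σ g⁻¹) h
    refine ⟨LinearMap.det T, MultilinearMap.ext fun v => ?_⟩
    rw [multilinearRep_apply, _root_.smul_apply, hω, hω, smul_eq_mul,
      ← Module.Basis.det_comp]
    rfl
  · rintro ⟨c, hc⟩ w hw
    rw [Submodule.mem_comap, hrad]
    intro v i
    have h1 := congrArg (fun α => α (Function.update (fun j => σ g (v j)) i w)) hc
    simp only [multilinearRep_apply, _root_.smul_apply, (hrad w).1 hw, smul_zero] at h1
    rw [← h1]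
    congr 1
    ext1 j
    rcases eq_or_ne j i with rfl | hj
    · simp
    · simp [hj]

/-- The quotient of a linear group by a closed normal subgroup is linear. -/
theorem exists_hom_ker_eq (G N : Subgroup (GL (Fin n) F)) (hN : zariskiClosure N ≤ N)
    (hnorm : ∀ g ∈ G, ∀ h ∈ N, g * h * g⁻¹ ∈ N) :
    ∃ (m : ℕ) (π : G →* GL (Fin m) F)
      (φ : Fin m → Fin m → GL (Fin n) F → F), (∀ i j, φ i j ∈ regularFun F n) ∧
      (∀ (g : G) i j, (π g : Matrix (Fin m) (Fin m) F) i j = φ i j g) ∧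
      ∀ g : G, π g = 1 ↔ (g : GL (Fin n) F) ∈ N := by
  obtain ⟨W, _, _, _, σ, M, hσ, hM⟩ := exists_rep_submodule G N hN
  obtain ⟨E, _, _, _, τ, ω, hτ, hω, hstab⟩ := exists_rep_line hσ M
  have hstab' : ∀ g : G, (g : GL (Fin n) F) ∈ N ↔ ∃ c : F, τ g ω = c • ω := fun g => by
    rw [← hstab, ← hM, Subgroup.coe_inv, inv_mem_iff]
  have : (N.subgroupOf G).Normal := ⟨fun h hh g => hnorm g g.2 h hh⟩
  obtain ⟨B, _, _, _, ρ, hρ, htriv, hker⟩ := exists_rep_trivial_on_normal hτ (N.subgroupOf G) hω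
    fun h hh => (hstab' h).1 hh
  obtain ⟨m, π, φ, hφ, hπ, hπ1⟩ := hρ.exists_matrix
  exact ⟨m, π, φ, hφ, hπ, fun g => ⟨fun h => (hstab' g).2 (hker g ((hπ1 g).1 h)),
    fun h => (hπ1 g).2 (htriv g h)⟩⟩

end Translation

section ExactSequence

variable {F : Type} [Field F] {n : ℕ}

theorem exists_subgroup_mem_iff_isUnipotentElt [CharZero F] (G : Subgroup (GL (Fin n) F))
    [Group.IsSolvable G] :
    ∃ U : Subgroup (GL (Fin n) F), ∀ g, g ∈ U ↔ g ∈ G ∧ IsUnipotentElt F n g := by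
  have hS : {g | g ∈ G ∧ IsUnipotentElt F n g} ⊆ (G : Set (GL (Fin n) F)) := fun g hg => hg.1
  refine ⟨Subgroup.closure {g | g ∈ G ∧ IsUnipotentElt F n g}, fun g => ⟨fun hg => ⟨?_, ?_⟩,
    fun hg => Subgroup.subset_closure hg⟩⟩
  · exact (Subgroup.closure_le G).2 hS hg
  · exact isUnipotentElt_of_mem_closure hS (fun s hs => hs.2) hg

theorem nRankLe.unipDim_le {Δ : Type} [Group Δ] {k : ℕ} (h : nRankLe F Δ k)
    (ρ : Δ →* GL (Fin n) F) {U : Subgroup (GL (Fin n) F)}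
    (hU : ∀ g, g ∈ U ↔ g ∈ zariskiClosure ρ.range ∧ IsUnipotentElt F n g) :
    unipDim F n U ≤ k :=
  h n (zariskiClosure ρ.range) U ρ (isAlgebraicSubgroup_zariskiClosure _)
    (fun δ => le_zariskiClosure _ ⟨δ, rfl⟩)
    (fun H hH hρ => zariskiClosure_le hH (by rintro _ ⟨δ, rfl⟩; exact hρ δ))
    (fun g hg => ((hU g).1 hg).1) (fun g hg => ((hU g).1 hg).2) fun g hg hg' => (hU g).2 ⟨hg, hg'⟩

/-- A regular homomorphism maps the closure of a subgroup into the closure of its image. -/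
theorem map_mem_zariskiClosure {H G : Subgroup (GL (Fin n) F)} {m : ℕ} (π : G →* GL (Fin m) F)
    {φ : Fin m → Fin m → GL (Fin n) F → F} (hφ : ∀ i j, φ i j ∈ regularFun F n)
    (hπ : ∀ (g : G) i j, (π g : Matrix (Fin m) (Fin m) F) i j = φ i j g)
    {L : Subgroup (GL (Fin m) F)} (hH : ∀ h (hG : h ∈ G), h ∈ H → π ⟨h, hG⟩ ∈ L) (hHG : H ≤ G)
    (g : G) (hg : (g : GL (Fin n) F) ∈ zariskiClosure H) : π g ∈ zariskiClosure L := by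
  intro p hp
  have hval : ∀ g : G, (π g : Matrix (Fin m) (Fin m) F) = Matrix.of fun i j => φ i j g :=
    fun g => Matrix.ext fun i j => hπ g i j
  have hreg := evalMat_mem_regularFun p (a := fun x => Matrix.of fun i j => φ i j x) hφ
  rw [hval]
  refine regular_vanish hreg (fun h hh => ?_) hg
  have := hp _ (hH h (hHG hh) hh)
  rwa [hval] at this

/-- Subadditivity of the dimension of the unipotent radical along a regular homomorphism. -/
theorem unipDim_le_add [CharZero F] {G U U' : Subgroup (GL (Fin n) F)} {m : ℕ} {U'' : Subgroup (GL (Fin m) F)}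
    (hG : zariskiClosure G ≤ G) (hUG : U ≤ G) [Group.IsSolvable U]
    (hU : ∀ u ∈ U, IsUnipotentElt F n u) (π : G →* GL (Fin m) F)
    {φ : Fin m → Fin m → GL (Fin n) F → F} (hφ : ∀ i j, φ i j ∈ regularFun F n)
    (hπ : ∀ (g : G) i j, (π g : Matrix (Fin m) (Fin m) F) i j = φ i j g)
    (hker : ∀ g : G, π g = 1 → IsUnipotentElt F n g → (g : GL (Fin n) F) ∈ U')
    (himg : ∀ g : G, IsUnipotentElt F m (π g) → π g ∈ U'') :
    unipDim F n U ≤ unipDim F n U' + unipDim F m U'' := by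
  obtain ⟨δ, hδ⟩ := exists_differential π hφ hπ
  let V := Submodule.span F (matLog F n '' (U : Set (GL (Fin n) F)))
  let V' := Submodule.span F (matLog F n '' (U' : Set (GL (Fin n) F)))
  let V'' := Submodule.span F (matLog F m '' (U'' : Set (GL (Fin m) F)))
  have hmap : V.map δ ≤ V'' := by
    rw [Submodule.map_span, Submodule.span_le]
    rintro _ ⟨_, ⟨u, hu, rfl⟩, rfl⟩
    obtain ⟨P, rfl, hP⟩ := exists_oneParam_of_isUnipotentElt (hU u hu)
    obtain ⟨Q, hQ, hQπ⟩ := hδ P fun t => hG (gl_mem_of_gl_one_mem (hUG hu) t)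
    rw [← hP, ← hQ, ← Q.matLog_gl_one]
    refine Submodule.subset_span ⟨_, ?_, rfl⟩
    have h1 := Q.isUnipotentElt_gl 1
    rw [hQπ] at h1 ⊢
    exact himg _ h1
  have hker' : (LinearMap.ker (δ.domRestrict V)).map V.subtype ≤ V' := by
    rintro _ ⟨X, hX, rfl⟩
    obtain ⟨P, hPX, hPG⟩ := exists_oneParam_of_mem_span hG hUG hU X.2
    obtain ⟨Q, hQ, hQπ⟩ := hδ P hPG
    have hδX : δ X = 0 := hX
    rw [Submodule.subtype_apply, ← hPX, ← P.matLog_gl_one]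
    refine Submodule.subset_span ⟨_, ?_, rfl⟩
    refine hker ⟨P.gl 1, hPG 1⟩ ?_ (P.isUnipotentElt_gl 1)
    rw [← hQπ]
    exact Q.gl_eq_one_of_tangent_eq_zero (by rw [hQ, hPX, hδX]) 1
  have h1 := LinearMap.finrank_range_add_finrank_ker (δ.domRestrict V)
  rw [LinearMap.range_domRestrict] at h1
  have h2 := Submodule.finrank_mono hmap
  have h3 := Submodule.finrank_mono hker'
  rw [Submodule.finrank_map_subtype_eq] at h3
  change Module.finrank F V ≤ Module.finrank F V' + Module.finrank F V''
  omega

end ExactSequence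

/-- If `1 → Γ' → Γ → Γ'' → 1` is a short exact sequence of solvable groups of
finite rank, and `n(Δ, F)` denotes the supremum of `dim U(G)` over all
homomorphisms `Δ → G(F)` with Zariski dense image into algebraic groups `G`
over `F` (a field of characteristic `0`), then
`n(Γ, F) ≤ n(Γ', F) + n(Γ'', F)`. -/
theorem statement17 (F : Type) [Field F] [CharZero F]
    {Γ' Γ Γ'' : Type} [Group Γ'] [Group Γ] [Group Γ'']
    (hΓ' : SolvableFiniteRank Γ') (hΓ : SolvableFiniteRank Γ)
    (hΓ'' : SolvableFiniteRank Γ'')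
    (f : Γ' →* Γ) (g : Γ →* Γ'')
    (hf : Function.Injective f) (hg : Function.Surjective g)
    (hexact : g.ker = f.range)
    (k' k'' : ℕ) (h' : nRankLe F Γ' k') (h'' : nRankLe F Γ'' k'') :
    nRankLe F Γ (k' + k'') := by
  intro n G U ρ hGalg hρG hGmin hUG hUunip hUmax
  have := hΓ'.isSolvable
  have := hΓ.isSolvable
  have := hΓ''.isSolvable
  have hρrange : ρ.range ≤ G := by rintro _ ⟨δ, rfl⟩; exact hρG δ
  have hGeq : G = zariskiClosure ρ.range :=
    le_antisymm (hGmin _ (isAlgebraicSubgroup_zariskiClosure _)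
      fun δ => le_zariskiClosure _ ⟨δ, rfl⟩) (zariskiClosure_le hGalg hρrange)
  have : Group.IsSolvable U := by
    have := isSolvable_zariskiClosure_range ρ
    exact Group.isSolvable_of_isSolvable_injective (Subgroup.inclusion_injective (hUG.trans hGeq.le))
  let N := zariskiClosure (ρ.comp f).range
  have : Group.IsSolvable N := isSolvable_zariskiClosure_range (ρ.comp f)
  obtain ⟨U', hU'⟩ := exists_subgroup_mem_iff_isUnipotentElt N
  have hcomm : ⁅ρ.range, (ρ.comp f).range⁆ ≤ (ρ.comp f).range := by
    rw [MonoidHom.range_comp, ← hexact, MonoidHom.range_eq_map ρ, ← Subgroup.map_commutator]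
    exact Subgroup.map_mono (Subgroup.commutator_le_right _ _)
  obtain ⟨m, π, φ, hφ, hπ, hπ1⟩ := exists_hom_ker_eq G N
    (zariskiClosure_le (isAlgebraicSubgroup_zariskiClosure _) le_rfl)
    fun a ha b hb => zariskiClosure_conj_mem hcomm (hGeq ▸ ha) hb
  let σ : Γ →* GL (Fin m) F := π.comp (ρ.codRestrict G hρG)
  have hσ : g.ker ≤ σ.ker := by
    rw [hexact]
    rintro _ ⟨x, rfl⟩
    exact (hπ1 _).2 (le_zariskiClosure _ ⟨x, rfl⟩)
  let ρ'' : Γ'' →* GL (Fin m) F := g.liftOfSurjective hg ⟨σ, hσ⟩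
  have hρ'' : ∀ x, ρ'' (g x) = σ x := fun x => g.liftOfRightInverse_comp_apply _ _ ⟨σ, hσ⟩ x
  have : Group.IsSolvable (zariskiClosure ρ''.range) := isSolvable_zariskiClosure_range ρ''
  obtain ⟨U'', hU''⟩ := exists_subgroup_mem_iff_isUnipotentElt (zariskiClosure ρ''.range)
  refine (unipDim_le_add (U' := U') (U'' := U'')
    (zariskiClosure_le hGalg le_rfl) hUG hUunip π hφ hπ
    (fun x hx hxu => (hU' _).2 ⟨(hπ1 x).1 hx, hxu⟩) fun x hx => (hU'' _).2 ⟨?_, hx⟩).trans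
    (add_le_add (h'.unipDim_le _ hU') (h''.unipDim_le _ hU''))
  refine map_mem_zariskiClosure π hφ hπ (H := ρ.range) ?_ hρrange x (hGeq ▸ x.2)
  rintro _ hx ⟨y, rfl⟩
  exact ⟨g y, hρ'' y⟩
end
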